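/- arXiv:1101.5256 — 3 statements merged into one kernel-verified Lean document; each statement's English description precedes it below -/
import Mathlib

section
/- (Atomistic stress representation of the first variation.) For all y, z ∈ 𝓨, ε² Σ_{x∈𝓛} Σ_{r∈ℛ} ∂_r V(D_ℛ y(x)) · D_r z(x) = Σ_{T∈𝒯_ε} |T| Σ_a(y; T) : ∇z(T), where the left-hand side is the first variation ⟨δE_a(y), z⟩ of the atomistic energy, the sum on the right runs over all triangles of 𝒯_ε, ∇z(T) is the constant gradient of the piecewise affine interpolant of z on T, and A : B denotes the Frobenius inner product. -/
open scoped BigOperators RealInnerProductSpace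
open MeasureTheory Filter

noncomputable section

/-- 2×2 real matrices, represented as the finite-dimensional space `Fin 2 → Fin 2 → ℝ`. -/
abbrev Mat2 := Fin 2 → Fin 2 → ℝ

/-- Real vector with coordinates `f`. -/
def toV2 (f : Fin 2 → ℝ) : EuclideanSpace ℝ (Fin 2) :=
  (WithLp.equiv 2 (Fin 2 → ℝ)).symm f

/-- The point `εz ∈ ℝ²` of the scaled lattice `εℤ²`. -/
def latpt (ε : ℝ) (z : Fin 2 → ℤ) : EuclideanSpace ℝ (Fin 2) :=
  toV2 fun i => ε * (z i : ℝ)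

/-- The integer vector `r` as a real vector. -/
def zvec (r : Fin 2 → ℤ) : EuclideanSpace ℝ (Fin 2) :=
  toV2 fun i => (r i : ℝ)

/-- The standard basis vectors `e₁, e₂` of `ℤ²`. -/
def eint (j : Fin 2) : Fin 2 → ℤ := Pi.single j 1

/-- The finite difference operator `D_r v(x) = (v(x+εr) − v(x))/ε`. -/
def fd2 (ε : ℝ) (r : Fin 2 → ℤ) (v : (Fin 2 → ℤ) → EuclideanSpace ℝ (Fin 2))
    (x : Fin 2 → ℤ) : EuclideanSpace ℝ (Fin 2) :=
  ε⁻¹ • (v (x + r) - v x)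

/-- The periodic reference cell `𝓛 = ε·{−N+1,…,N}²` in integer coordinates. -/
def cell2 (N : ℕ) : Finset (Fin 2 → ℤ) :=
  Fintype.piFinset fun _ => Finset.Icc (-(N : ℤ) + 1) (N : ℤ)

/-- Base points `ε·{−N,…,N−1}²` of the cells of the triangulation `𝒯_ε` of `[−1,1]²`. -/
def base2 (N : ℕ) : Finset (Fin 2 → ℤ) :=
  Fintype.piFinset fun _ => Finset.Icc (-(N : ℤ)) ((N : ℤ) - 1)

/-- Lower triangle `conv{x, x+εe₁, x+εe₂}` of the cell at `x`. -/
def Tlo (ε : ℝ) (x : Fin 2 → ℤ) : Set (EuclideanSpace ℝ (Fin 2)) :=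
  convexHull ℝ {latpt ε x, latpt ε (x + eint 0), latpt ε (x + eint 1)}

/-- Upper triangle `conv{x+εe₁, x+εe₂, x+ε(e₁+e₂)}` of the cell at `x`. -/
def Tup (ε : ℝ) (x : Fin 2 → ℤ) : Set (EuclideanSpace ℝ (Fin 2)) :=
  convexHull ℝ {latpt ε (x + eint 0), latpt ε (x + eint 1), latpt ε (x + eint 0 + eint 1)}

/-- Gradient of the piecewise affine interpolant of `z` on the lower triangle at `x`:
the matrix with columns `D_{e₁}z(x)` and `D_{e₂}z(x)`. -/
def gradLo (ε : ℝ) (z : (Fin 2 → ℤ) → EuclideanSpace ℝ (Fin 2)) (x : Fin 2 → ℤ) : Mat2 :=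
  fun i j => (WithLp.equiv 2 (Fin 2 → ℝ)) (fd2 ε (eint j) z x) i

/-- Gradient of the piecewise affine interpolant of `z` on the upper triangle at `x`:
the matrix with columns `D_{e₁}z(x+εe₂)` and `D_{e₂}z(x+εe₁)`. -/
def gradUp (ε : ℝ) (z : (Fin 2 → ℤ) → EuclideanSpace ℝ (Fin 2)) (x : Fin 2 → ℤ) : Mat2 :=
  fun i j => (WithLp.equiv 2 (Fin 2 → ℝ)) (fd2 ε (eint j) z (x + eint (![1, 0] j))) i

/-- Frobenius inner product `A : B`. -/
def frob (A B : Mat2) : ℝ := ∑ i, ∑ j, A i j * B i j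

/-- The tensor product `a ⊗ r`, `(a ⊗ r)_{ij} = a_i r_j`. -/
def outer (a : EuclideanSpace ℝ (Fin 2)) (r : Fin 2 → ℤ) : Mat2 :=
  fun i j => (WithLp.equiv 2 (Fin 2 → ℝ)) a i * (r j : ℝ)

/-- The bond integral `⨍_x^{x+εr} χ db`. -/
def bondInt (ε : ℝ) (χ : EuclideanSpace ℝ (Fin 2) → ℝ) (x r : Fin 2 → ℤ) : ℝ :=
  ∫ t in (0:ℝ)..1, χ (latpt ε x + t • (ε • zvec r))

/-- `χ` satisfies the defining density limit of `χ_T`. -/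
def IsDensityFn (T : Set (EuclideanSpace ℝ (Fin 2))) (χ : EuclideanSpace ℝ (Fin 2) → ℝ) : Prop :=
  ∀ x : EuclideanSpace ℝ (Fin 2),
    Tendsto (fun t : ℝ =>
        (volume (T ∩ Metric.closedBall x t)).toReal / (volume (Metric.closedBall x t)).toReal)
      (nhdsWithin 0 (Set.Ioi 0)) (nhds (χ x))

/-- The atomistic stress function
`Σ_a(y;T) = Σ_{r∈ℛ} (ε²/|T|) Σ_{x∈εℤ²} [∂_r V(D_ℛ y(x)) ⊗ r] ⨍_x^{x+εr} χ_T db`. -/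
def Sa (ε : ℝ) (R : Finset (Fin 2 → ℤ))
    (DV : (R → EuclideanSpace ℝ (Fin 2)) → R → EuclideanSpace ℝ (Fin 2))
    (y : (Fin 2 → ℤ) → EuclideanSpace ℝ (Fin 2)) (area : ℝ)
    (χ : EuclideanSpace ℝ (Fin 2) → ℝ) : Mat2 :=
  ∑ r : R, (ε ^ 2 / area)
    • ∑' x : Fin 2 → ℤ, bondInt ε χ x (↑r) • outer (DV (fun s => fd2 ε (↑s) y x) r) (↑r)

/-- Membership in `𝓨`: `y − y_A` is `2ℤ²`-periodic for some matrix `A`. -/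
def InY (N : ℕ) (y : (Fin 2 → ℤ) → EuclideanSpace ℝ (Fin 2)) : Prop :=
  ∃ A : Mat2, ∀ x ξ : Fin 2 → ℤ,
    y (x + (2 * N : ℤ) • ξ) = y x + toV2 fun i => ∑ j, A i j * (2 * (ξ j : ℝ))

theorem smul_add_smul_add_smul_mem_convexHull_triple {E : Type*} [AddCommGroup E] [Module ℝ E]
    (x y z : E) {a b c : ℝ} (ha : 0 ≤ a) (hb : 0 ≤ b) (hc : 0 ≤ c) (h : a + b + c = 1) :
    a • x + b • y + c • z ∈ convexHull ℝ {x, y, z} := by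
  have := (convex_convexHull ℝ {x, y, z}).sum_mem (t := Finset.univ) (w := ![a, b, c])
    (z := ![x, y, z]) (by simp [Fin.forall_fin_succ, *]) (by simp [Fin.sum_univ_three, h])
    (by
      simp only [Finset.mem_univ, forall_const, Fin.forall_fin_succ]
      exact ⟨subset_convexHull _ _ (by simp), subset_convexHull _ _ (by simp),
        subset_convexHull _ _ (by simp), fun i => i.elim0⟩)
  simpa [Fin.sum_univ_three] using this

theorem mem_Tlo {ε : ℝ} (hε : 0 < ε) (n : Fin 2 → ℤ) (p : EuclideanSpace ℝ (Fin 2)) :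
    p ∈ Tlo ε n ↔ ε * n 0 ≤ p 0 ∧ ε * n 1 ≤ p 1 ∧ p 0 + p 1 ≤ ε * (n 0 + n 1 + 1) := by
  constructor
  · rw [Tlo, convexHull_insert (by simp), convexHull_pair]
    intro h
    simp only [mem_convexJoin, Set.mem_singleton_iff, exists_eq_left] at h
    obtain ⟨q, ⟨a, b, ha, hb, hab, rfl⟩, c, d, hc, hd, hcd, rfl⟩ := h
    obtain rfl : a = 1 - b := by linarith
    obtain rfl : c = 1 - d := by linarith
    simp only [latpt, toV2, eint, WithLp.equiv_symm_apply, PiLp.add_apply, PiLp.smul_apply,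
      Pi.add_apply, Pi.single_apply, smul_eq_mul]
    norm_num
    have h1 := mul_nonneg hε.le (mul_nonneg hd ha)
    have h2 := mul_nonneg hε.le (mul_nonneg hd hb)
    have h3 := mul_nonneg hε.le hc
    refine ⟨?_, ?_, ?_⟩ <;> linarith
  · rintro ⟨h0, h1, h2⟩
    have key := smul_add_smul_add_smul_mem_convexHull_triple (latpt ε n) (latpt ε (n + eint 0))
      (latpt ε (n + eint 1)) (a := (ε * (n 0 + n 1 + 1) - (p 0 + p 1)) / ε)
      (b := (p 0 - ε * n 0) / ε) (c := (p 1 - ε * n 1) / ε)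
      (div_nonneg (by linarith) hε.le) (div_nonneg (by linarith) hε.le)
      (div_nonneg (by linarith) hε.le) (by field_simp; ring)
    rw [Tlo]
    convert key using 1
    ext i
    fin_cases i <;>
      simp [latpt, toV2, eint] <;> field_simp <;> ring

theorem mem_Tup {ε : ℝ} (hε : 0 < ε) (n : Fin 2 → ℤ) (p : EuclideanSpace ℝ (Fin 2)) :
    p ∈ Tup ε n ↔
      p 0 ≤ ε * (n 0 + 1) ∧ p 1 ≤ ε * (n 1 + 1) ∧ ε * (n 0 + n 1 + 1) ≤ p 0 + p 1 := by
  constructor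
  · rw [Tup, convexHull_insert (by simp), convexHull_pair]
    intro h
    simp only [mem_convexJoin, Set.mem_singleton_iff, exists_eq_left] at h
    obtain ⟨q, ⟨a, b, ha, hb, hab, rfl⟩, c, d, hc, hd, hcd, rfl⟩ := h
    obtain rfl : a = 1 - b := by linarith
    obtain rfl : c = 1 - d := by linarith
    simp only [latpt, toV2, eint, WithLp.equiv_symm_apply, PiLp.add_apply, PiLp.smul_apply,
      Pi.add_apply, Pi.single_apply, smul_eq_mul]
    norm_num
    have h1 := mul_nonneg hε.le (mul_nonneg hd ha)
    have h2 := mul_nonneg hε.le (mul_nonneg hd hb)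
    have h3 := mul_nonneg hε.le hc
    refine ⟨?_, ?_, ?_⟩ <;> linarith
  · rintro ⟨h0, h1, h2⟩
    have key := smul_add_smul_add_smul_mem_convexHull_triple (latpt ε (n + eint 0))
      (latpt ε (n + eint 1)) (latpt ε (n + eint 0 + eint 1)) (a := (ε * (n 1 + 1) - p 1) / ε)
      (b := (ε * (n 0 + 1) - p 0) / ε) (c := (p 0 + p 1 - ε * (n 0 + n 1 + 1)) / ε)
      (div_nonneg (by linarith) hε.le) (div_nonneg (by linarith) hε.le)
      (div_nonneg (by linarith) hε.le) (by field_simp; ring)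
    rw [Tup]
    convert key using 1
    ext i
    fin_cases i <;>
      simp [latpt, toV2, eint] <;> field_simp <;> ring

/-- The triangles of the cell at `n`: the lower one for `false`, the upper one for `true`. -/
def latticeTriangle (ε : ℝ) : Bool → (Fin 2 → ℤ) → Set (EuclideanSpace ℝ (Fin 2))
  | false => Tlo ε
  | true => Tup ε

theorem isCompact_latticeTriangle (ε : ℝ) (b : Bool) (n : Fin 2 → ℤ) :
    IsCompact (latticeTriangle ε b n) := by
  cases b <;> exact Set.Finite.isCompact_convexHull _ (Set.toFinite _)

/-- The interior of `latticeTriangle ε b n`, described by strict inequalities. -/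
def openLatticeTriangle (ε : ℝ) : Bool → (Fin 2 → ℤ) → Set (EuclideanSpace ℝ (Fin 2))
  | false, n => {p | ε * n 0 < p 0 ∧ ε * n 1 < p 1 ∧ p 0 + p 1 < ε * (n 0 + n 1 + 1)}
  | true, n =>
    {p | p 0 < ε * (n 0 + 1) ∧ p 1 < ε * (n 1 + 1) ∧ ε * (n 0 + n 1 + 1) < p 0 + p 1}

theorem isOpen_openLatticeTriangle (ε : ℝ) (b : Bool) (n : Fin 2 → ℤ) :
    IsOpen (openLatticeTriangle ε b n) := by
  cases b <;> simp only [openLatticeTriangle, Set.ofPred_and] <;>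
    refine IsOpen.inter ?_ (IsOpen.inter ?_ ?_) <;> exact isOpen_lt (by fun_prop) (by fun_prop)

theorem openLatticeTriangle_subset {ε : ℝ} (hε : 0 < ε) (b : Bool) (n : Fin 2 → ℤ) :
    openLatticeTriangle ε b n ⊆ latticeTriangle ε b n := by
  cases b
  · rintro p ⟨h0, h1, h2⟩
    exact (mem_Tlo hε n p).2 ⟨h0.le, h1.le, h2.le⟩
  · rintro p ⟨h0, h1, h2⟩
    exact (mem_Tup hε n p).2 ⟨h0.le, h1.le, h2.le⟩

theorem openLatticeTriangle_nonempty {ε : ℝ} (hε : 0 < ε) (b : Bool) (n : Fin 2 → ℤ) :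
    (openLatticeTriangle ε b n).Nonempty := by
  cases b
  · refine ⟨toV2 ![ε * (n 0 + 1 / 3), ε * (n 1 + 1 / 3)], ?_⟩
    simp only [openLatticeTriangle, toV2, Set.mem_ofPred_eq, WithLp.equiv_symm_apply,
      Matrix.cons_val_zero, Matrix.cons_val_one]
    refine ⟨?_, ?_, ?_⟩ <;> nlinarith
  · refine ⟨toV2 ![ε * (n 0 + 2 / 3), ε * (n 1 + 2 / 3)], ?_⟩
    simp only [openLatticeTriangle, toV2, Set.mem_ofPred_eq, WithLp.equiv_symm_apply,
      Matrix.cons_val_zero, Matrix.cons_val_one]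
    refine ⟨?_, ?_, ?_⟩ <;> nlinarith

theorem volume_latticeTriangle_ne_zero {ε : ℝ} (hε : 0 < ε) (b : Bool) (n : Fin 2 → ℤ) :
    (volume (latticeTriangle ε b n)).toReal ≠ 0 :=
  (ENNReal.toReal_pos (((isOpen_openLatticeTriangle ε b n).measure_pos volume
      (openLatticeTriangle_nonempty hε b n)).trans_le
        (measure_mono (openLatticeTriangle_subset hε b n))).ne'
    (isCompact_latticeTriangle ε b n).measure_lt_top.ne).ne'

theorem coord_mem_of_mem_latticeTriangle {ε : ℝ} (hε : 0 < ε) {b : Bool} {n : Fin 2 → ℤ}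
    {p : EuclideanSpace ℝ (Fin 2)} (hp : p ∈ latticeTriangle ε b n) (i : Fin 2) :
    ε * n i ≤ p i ∧ p i ≤ ε * (n i + 1) := by
  cases b
  · obtain ⟨h0, h1, h2⟩ := (mem_Tlo hε n p).1 hp
    fin_cases i <;> constructor <;> dsimp <;> linarith
  · obtain ⟨h0, h1, h2⟩ := (mem_Tup hε n p).1 hp
    fin_cases i <;> constructor <;> dsimp <;> linarith

theorem latpt_add_mem_latticeTriangle {ε : ℝ} (hε : 0 < ε) (b : Bool) (n k : Fin 2 → ℤ)
    (p : EuclideanSpace ℝ (Fin 2)) :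
    latpt ε k + p ∈ latticeTriangle ε b (k + n) ↔ p ∈ latticeTriangle ε b n := by
  cases b
  · refine (mem_Tlo hε _ _).trans (Iff.trans ?_ (mem_Tlo hε _ _).symm)
    simp [latpt, toV2]
    refine and_congr ?_ (and_congr ?_ ?_) <;> constructor <;> intro h <;> linarith
  · refine (mem_Tup hε _ _).trans (Iff.trans ?_ (mem_Tup hε _ _).symm)
    simp [latpt, toV2]
    refine and_congr ?_ (and_congr ?_ ?_) <;> constructor <;> intro h <;> linarith

theorem eq_of_mem_openLatticeTriangle {ε : ℝ} (hε : 0 < ε) {b b' : Bool} {n n' : Fin 2 → ℤ}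
    {p : EuclideanSpace ℝ (Fin 2)} (hp : p ∈ openLatticeTriangle ε b n)
    (hp' : p ∈ latticeTriangle ε b' n') : b' = b ∧ n' = n := by
  have hn : n' = n := by
    have key : ∀ i, ε * n i < p i ∧ p i < ε * (n i + 1) := by
      cases b <;> obtain ⟨h0, h1, h2⟩ := hp <;> intro i <;> fin_cases i <;> constructor <;>
        dsimp <;> linarith
    funext i
    obtain ⟨h1, h2⟩ := key i
    obtain ⟨h3, h4⟩ := coord_mem_of_mem_latticeTriangle hε hp' i
    have h5 : (n i : ℝ) < n' i + 1 := lt_of_mul_lt_mul_left (h1.trans_le h4) hε.le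
    have h6 : (n' i : ℝ) < n i + 1 := lt_of_mul_lt_mul_left (h3.trans_lt h2) hε.le
    norm_cast at h5 h6
    omega
  refine ⟨?_, hn⟩
  subst hn
  cases b <;> cases b' <;> try rfl
  · exact absurd hp.2.2 ((mem_Tup hε _ p).1 hp').2.2.not_gt
  · exact absurd hp.2.2 ((mem_Tlo hε _ p).1 hp').2.2.not_gt

/-- The points of the plane on none of the lines that support edges of lattice triangles. -/
def offGrid (ε : ℝ) : Set (EuclideanSpace ℝ (Fin 2)) :=
  {p | ∀ m : ℤ, p 0 ≠ ε * m ∧ p 1 ≠ ε * m ∧ p 0 + p 1 ≠ ε * m}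

theorem exists_mem_openLatticeTriangle {ε : ℝ} (hε : 0 < ε) {p : EuclideanSpace ℝ (Fin 2)}
    (hp : p ∈ offGrid ε) : ∃ b n, p ∈ openLatticeTriangle ε b n := by
  have key : ∀ x : ℝ, (∀ m : ℤ, x ≠ ε * m) → ε * ⌊x / ε⌋ < x ∧ x < ε * (⌊x / ε⌋ + 1) := by
    intro x hx
    have h1 := Int.floor_le (x / ε)
    have h2 := Int.lt_floor_add_one (x / ε)
    rw [le_div_iff₀ hε] at h1
    rw [div_lt_iff₀ hε] at h2
    refine ⟨lt_of_le_of_ne (by linarith) (hx _).symm, by linarith⟩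
  obtain ⟨h0, h0'⟩ := key (p 0) fun m => (hp m).1
  obtain ⟨h1, h1'⟩ := key (p 1) fun m => (hp m).2.1
  have h2 := (hp (⌊p 0 / ε⌋ + ⌊p 1 / ε⌋ + 1)).2.2
  push_cast at h2
  rcases lt_or_gt_of_ne h2 with h | h
  · exact ⟨false, ![⌊p 0 / ε⌋, ⌊p 1 / ε⌋], by simpa [openLatticeTriangle] using ⟨h0, h1, h⟩⟩
  · exact ⟨true, ![⌊p 0 / ε⌋, ⌊p 1 / ε⌋], by simpa [openLatticeTriangle] using ⟨h0', h1', h⟩⟩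

theorem volume_level_set_eq_zero {E : Type*} [NormedAddCommGroup E] [NormedSpace ℝ E]
    [FiniteDimensional ℝ E] [MeasurableSpace E] [BorelSpace E] (μ : Measure E)
    [μ.IsAddHaarMeasure] {l : E →ₗ[ℝ] ℝ} {v : E} (hv : l v = 1) (c : ℝ) :
    μ {w | l w = c} = 0 := by
  have hS := Measure.addHaar_affineSubspace μ (AffineSubspace.mk' (c • v) (LinearMap.ker l)) (by
    intro h
    have h1 : (c + 1) • v ∈ AffineSubspace.mk' (c • v) (LinearMap.ker l) := h ▸ trivial
    simp [AffineSubspace.mem_mk', hv] at h1)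
  refine measure_mono_null (fun w hw => ?_) hS
  simp only [Set.mem_ofPred_eq] at hw
  simp [AffineSubspace.mem_mk', hv, hw]

theorem ae_mem_offGrid (ε : ℝ) : ∀ᵐ w : EuclideanSpace ℝ (Fin 2), w ∈ offGrid ε := by
  have h : ∀ (l : EuclideanSpace ℝ (Fin 2) →ₗ[ℝ] ℝ), l (EuclideanSpace.single 0 1) = 1 ∨
      l (EuclideanSpace.single 1 1) = 1 → ∀ m : ℤ, ∀ᵐ w, l w ≠ ε * m := by
    intro l hl m
    rw [ae_iff]
    simp only [not_not]
    rcases hl with hl | hl <;> exact volume_level_set_eq_zero volume hl _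
  have h0 := h (EuclideanSpace.proj 0).toLinearMap (by simp)
  have h1 := h (EuclideanSpace.proj 1).toLinearMap (by simp)
  have h2 := h ((EuclideanSpace.proj 0).toLinearMap + (EuclideanSpace.proj 1).toLinearMap)
    (by simp)
  refine ae_all_iff.2 fun m => ?_
  filter_upwards [h0 m, h1 m, h2 m] with w h0 h1 h2
  exact ⟨by simpa using h0, by simpa using h1, by simpa using h2⟩

theorem countable_smul_add_notMem_offGrid {ε : ℝ} (v : EuclideanSpace ℝ (Fin 2))
    {w : EuclideanSpace ℝ (Fin 2)} (hw : w ∈ offGrid ε) :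
    {t : ℝ | t • v + w ∉ offGrid ε}.Countable := by
  have h : ∀ a b : ℝ, (∀ m : ℤ, b ≠ ε * m) → {t : ℝ | ∃ m : ℤ, t * a + b = ε * m}.Countable := by
    intro a b hb
    rw [Set.ofPred_exists]
    refine Set.countable_iUnion fun m => Set.Subsingleton.countable fun t ht s hs => ?_
    simp only [Set.mem_ofPred_eq] at ht hs
    have ha : a ≠ 0 := by
      rintro rfl
      exact hb m (by simpa using ht)
    exact mul_right_cancel₀ ha (by linarith)
  refine (((h (v 0) (w 0) fun m => (hw m).1).union (h (v 1) (w 1) fun m => (hw m).2.1)).union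
    (h (v 0 + v 1) (w 0 + w 1) fun m => (hw m).2.2)).mono fun t ht => ?_
  simp only [offGrid, Set.mem_ofPred_eq, not_forall] at ht
  obtain ⟨m, hm⟩ := ht
  simp only [PiLp.add_apply, PiLp.smul_apply, smul_eq_mul] at hm
  by_contra hc
  simp only [Set.mem_union, Set.mem_ofPred_eq, not_or, not_exists] at hc
  exact hm ⟨hc.1.1 m, hc.1.2 m, fun h' => hc.2 m (by linarith)⟩

/-- The nodal hat function at the origin of the triangulation of the plane. -/
def hatFn (a b : ℝ) : ℝ := max 0 (1 - max (max |a| |b|) |a + b|)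

theorem hatFn_lower {a b : ℝ} (ha : 0 ≤ a) (hb : 0 ≤ b) (hab : a + b ≤ 1) (i j : ℤ) :
    hatFn (a - i) (b - j) = (if i = 0 ∧ j = 0 then 1 - a - b else 0)
      + (if i = 1 ∧ j = 0 then a else 0) + (if i = 0 ∧ j = 1 then b else 0) := by
  have far : 1 ≤ |a - i| ∨ 1 ≤ |b - j| ∨ 1 ≤ |a - i + (b - j)| → hatFn (a - i) (b - j) = 0 := by
    intro h
    refine max_eq_left (sub_nonpos.2 ?_)
    simpa [le_max_iff, or_assoc] using h
  have out : ∀ (x : ℝ) (k : ℤ), 0 ≤ x → x ≤ 1 → k ≤ -1 ∨ 2 ≤ k → 1 ≤ |x - k| := by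
    rintro x k h0 h1 (hk | hk)
    · have : (k : ℝ) ≤ -1 := by exact_mod_cast hk
      exact le_trans (by linarith) (le_abs_self _)
    · have : (2 : ℝ) ≤ k := by exact_mod_cast hk
      exact le_trans (by linarith) (neg_le_abs _)
  by_cases hi : i ≤ -1 ∨ 2 ≤ i
  · rw [far (Or.inl (out a i ha (by linarith) hi))]
    rw [if_neg (by omega), if_neg (by omega), if_neg (by omega)]
    simp
  by_cases hj : j ≤ -1 ∨ 2 ≤ j
  · rw [far (Or.inr (Or.inl (out b j hb (by linarith) hj)))]
    rw [if_neg (by omega), if_neg (by omega), if_neg (by omega)]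
    simp
  obtain rfl | rfl : i = 0 ∨ i = 1 := by omega
  · obtain rfl | rfl : j = 0 ∨ j = 1 := by omega
    · have : max (max |a| |b|) |a + b| = a + b := by
        rw [abs_of_nonneg ha, abs_of_nonneg hb, abs_of_nonneg (by linarith)]
        exact max_eq_right (max_le (by linarith) (by linarith))
      simp only [hatFn, Int.cast_zero, sub_zero, this]
      rw [max_eq_right (by linarith)]
      simp [sub_sub]
    · have : max (max |a| |b - 1|) |a + (b - 1)| = 1 - b := by
        rw [abs_of_nonneg ha, abs_of_nonpos (by linarith), abs_of_nonpos (by linarith)]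
        rw [max_eq_left (le_max_of_le_right (by linarith)), max_eq_right (by linarith)]
        ring
      simp only [hatFn, Int.cast_zero, Int.cast_one, sub_zero, this]
      rw [max_eq_right (by linarith)]
      simp
  · obtain rfl | rfl : j = 0 ∨ j = 1 := by omega
    · have : max (max |a - 1| |b|) |a - 1 + b| = 1 - a := by
        rw [abs_of_nonneg hb, abs_of_nonpos (by linarith : a - 1 ≤ 0), abs_of_nonpos (by linarith)]
        rw [max_eq_left (le_max_of_le_left (by linarith)), max_eq_left (by linarith)]
        ring
      simp only [hatFn, Int.cast_zero, Int.cast_one, sub_zero, this]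
      rw [max_eq_right (by linarith)]
      simp
    · rw [far (Or.inr (Or.inr (le_trans (by push_cast; linarith) (neg_le_abs _))))]
      simp

theorem hatFn_neg (a b : ℝ) : hatFn (-a) (-b) = hatFn a b := by
  simp only [hatFn, ← neg_add, abs_neg]

theorem hatFn_upper {a b : ℝ} (ha : a ≤ 1) (hb : b ≤ 1) (hab : 1 ≤ a + b) (i j : ℤ) :
    hatFn (a - i) (b - j) = (if i = 1 ∧ j = 1 then a + b - 1 else 0)
      + (if i = 0 ∧ j = 1 then 1 - a else 0) + (if i = 1 ∧ j = 0 then 1 - b else 0) := by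
  have h := hatFn_lower (sub_nonneg.2 ha) (sub_nonneg.2 hb) (by linarith) (1 - i) (1 - j)
  rw [← hatFn_neg]
  convert h using 1
  · push_cast
    congr 1 <;> ring
  · congr 1
    · congr 1
      · exact if_congr (by omega) (by ring) rfl
      · exact if_congr (by omega) rfl rfl
    · exact if_congr (by omega) rfl rfl

/-- The piecewise affine function with nodal values `u` on `S` and `0` elsewhere. -/
def nodalInterp (ε : ℝ) (S : Finset (Fin 2 → ℤ)) (u : (Fin 2 → ℤ) → ℝ)
    (p : EuclideanSpace ℝ (Fin 2)) : ℝ :=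
  ∑ k ∈ S, u k * hatFn (p 0 / ε - k 0) (p 1 / ε - k 1)

theorem continuous_nodalInterp (ε : ℝ) (S : Finset (Fin 2 → ℤ)) (u : (Fin 2 → ℤ) → ℝ) :
    Continuous (nodalInterp ε S u) := by
  unfold nodalInterp hatFn
  fun_prop

/-- The finite differences that make up the gradient of an interpolant on a lattice triangle. -/
def nodalDiff (u : (Fin 2 → ℤ) → ℝ) : Bool → (Fin 2 → ℤ) → Fin 2 → ℝ
  | false, n, j => u (n + eint j) - u n
  | true, n, j => u (n + eint (![1, 0] j) + eint j) - u (n + eint (![1, 0] j))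

theorem nodalInterp_lower {ε : ℝ} (hε : 0 < ε) {S : Finset (Fin 2 → ℤ)} (u : (Fin 2 → ℤ) → ℝ)
    {n : Fin 2 → ℤ} {p : EuclideanSpace ℝ (Fin 2)} (hp : p ∈ Tlo ε n)
    (h : n ∈ S) (h0 : n + eint 0 ∈ S) (h1 : n + eint 1 ∈ S) :
    nodalInterp ε S u p = u n + (p 0 / ε - n 0) * (u (n + eint 0) - u n)
      + (p 1 / ε - n 1) * (u (n + eint 1) - u n) := by
  obtain ⟨hp0, hp1, hp2⟩ := (mem_Tlo hε n p).1 hp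
  have e : ∀ k : Fin 2 → ℤ, u k * hatFn (p 0 / ε - k 0) (p 1 / ε - k 1) =
      (if k = n then u k * (1 - (p 0 / ε - n 0) - (p 1 / ε - n 1)) else 0)
      + (if k = n + eint 0 then u k * (p 0 / ε - n 0) else 0)
      + (if k = n + eint 1 then u k * (p 1 / ε - n 1) else 0) := by
    intro k
    have := hatFn_lower (a := p 0 / ε - n 0) (b := p 1 / ε - n 1)
      (by rw [sub_nonneg, le_div_iff₀ hε]; linarith)
      (by rw [sub_nonneg, le_div_iff₀ hε]; linarith)
      (by field_simp; linarith) (k 0 - n 0) (k 1 - n 1)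
    push_cast at this
    rw [sub_sub_sub_cancel_right, sub_sub_sub_cancel_right] at this
    rw [this, mul_add, mul_add, mul_ite, mul_ite, mul_ite, mul_zero]
    congr 1
    · congr 1
      · exact if_congr (by simp [funext_iff, Fin.forall_fin_two]; omega) rfl rfl
      · exact if_congr (by simp [funext_iff, Fin.forall_fin_two, eint]; omega) rfl rfl
    · exact if_congr (by simp [funext_iff, Fin.forall_fin_two, eint]; omega) rfl rfl
  simp only [nodalInterp, e, Finset.sum_add_distrib, Finset.sum_ite_eq', h, h0, h1, if_true]
  ring

theorem nodalInterp_upper {ε : ℝ} (hε : 0 < ε) {S : Finset (Fin 2 → ℤ)} (u : (Fin 2 → ℤ) → ℝ)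
    {n : Fin 2 → ℤ} {p : EuclideanSpace ℝ (Fin 2)} (hp : p ∈ Tup ε n)
    (h0 : n + eint 0 ∈ S) (h1 : n + eint 1 ∈ S) (h : n + eint 0 + eint 1 ∈ S) :
    nodalInterp ε S u p = u (n + eint 0 + eint 1)
      + (p 0 / ε - n 0 - 1) * (u (n + eint 0 + eint 1) - u (n + eint 1))
      + (p 1 / ε - n 1 - 1) * (u (n + eint 0 + eint 1) - u (n + eint 0)) := by
  obtain ⟨hp0, hp1, hp2⟩ := (mem_Tup hε n p).1 hp
  have e : ∀ k : Fin 2 → ℤ, u k * hatFn (p 0 / ε - k 0) (p 1 / ε - k 1) =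
      (if k = n + eint 0 + eint 1 then u k * ((p 0 / ε - n 0) + (p 1 / ε - n 1) - 1) else 0)
      + (if k = n + eint 1 then u k * (1 - (p 0 / ε - n 0)) else 0)
      + (if k = n + eint 0 then u k * (1 - (p 1 / ε - n 1)) else 0) := by
    intro k
    have := hatFn_upper (a := p 0 / ε - n 0) (b := p 1 / ε - n 1)
      (by rw [sub_le_iff_le_add, div_le_iff₀ hε]; linarith)
      (by rw [sub_le_iff_le_add, div_le_iff₀ hε]; linarith)
      (by field_simp; linarith) (k 0 - n 0) (k 1 - n 1)
    push_cast at this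
    rw [sub_sub_sub_cancel_right, sub_sub_sub_cancel_right] at this
    rw [this, mul_add, mul_add, mul_ite, mul_ite, mul_ite, mul_zero]
    congr 1
    · congr 1
      · exact if_congr (by simp [funext_iff, Fin.forall_fin_two, eint]; omega) rfl rfl
      · exact if_congr (by simp [funext_iff, Fin.forall_fin_two, eint]; omega) rfl rfl
    · exact if_congr (by simp [funext_iff, Fin.forall_fin_two, eint]; omega) rfl rfl
  simp only [nodalInterp, e, Finset.sum_add_distrib, Finset.sum_ite_eq', h, h0, h1, if_true]
  ring

/-- The index box `{-M, …, M}²`. -/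
def latticeBox (M : ℤ) : Finset (Fin 2 → ℤ) := Fintype.piFinset fun _ => Finset.Icc (-M) M

theorem mem_latticeBox {M : ℤ} {n : Fin 2 → ℤ} : n ∈ latticeBox M ↔ ∀ i, -M ≤ n i ∧ n i ≤ M := by
  simp [latticeBox]

theorem add_mem_latticeBox {M K : ℤ} {n m : Fin 2 → ℤ} (hn : n ∈ latticeBox M)
    (hm : m ∈ latticeBox K) : n + m ∈ latticeBox (M + K) := by
  simp only [mem_latticeBox, Pi.add_apply] at *
  intro i
  have := hn i
  have := hm i
  omega

theorem eint_mem_latticeBox (j : Fin 2) : eint j ∈ latticeBox 1 := by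
  rw [mem_latticeBox]
  intro i
  fin_cases i <;> fin_cases j <;> simp [eint]

theorem exists_nodalInterp_eq_affine {ε : ℝ} (hε : 0 < ε) {M : ℤ} (u : (Fin 2 → ℤ) → ℝ) (b : Bool)
    {n : Fin 2 → ℤ} (hn : n ∈ latticeBox M) :
    ∃ c : ℝ, ∀ p ∈ latticeTriangle ε b n, nodalInterp ε (latticeBox (M + 2)) u p =
      c + p 0 / ε * nodalDiff u b n 0 + p 1 / ε * nodalDiff u b n 1 := by
  have mono : ∀ {k : Fin 2 → ℤ} {K : ℤ}, K ≤ M + 2 → k ∈ latticeBox K →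
      k ∈ latticeBox (M + 2) := by
    intro k K hK hk
    rw [mem_latticeBox] at *
    intro i
    have := hk i
    omega
  have h0 := add_mem_latticeBox hn (eint_mem_latticeBox 0)
  have h1 := add_mem_latticeBox hn (eint_mem_latticeBox 1)
  have h2 := add_mem_latticeBox h0 (eint_mem_latticeBox 1)
  cases b
  · refine ⟨u n - n 0 * (u (n + eint 0) - u n) - n 1 * (u (n + eint 1) - u n), fun p hp => ?_⟩
    rw [nodalInterp_lower hε u hp (mono (by omega) hn) (mono (by omega) h0) (mono (by omega) h1)]
    simp only [nodalDiff]
    ring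
  · refine ⟨u (n + eint 0 + eint 1)
      - (n 0 + 1) * (u (n + eint 0 + eint 1) - u (n + eint 1))
      - (n 1 + 1) * (u (n + eint 0 + eint 1) - u (n + eint 0)), fun p hp => ?_⟩
    rw [nodalInterp_upper hε u hp (mono (by omega) h0) (mono (by omega) h1) (mono (by omega) h2)]
    simp only [nodalDiff, Matrix.cons_val_zero, Matrix.cons_val_one,
      add_right_comm n (eint 1) (eint 0)]
    ring

theorem nodalInterp_latpt {ε : ℝ} (hε : 0 < ε) {S : Finset (Fin 2 → ℤ)} (u : (Fin 2 → ℤ) → ℝ)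
    {k : Fin 2 → ℤ} (hk : k ∈ S) : nodalInterp ε S u (latpt ε k) = u k := by
  have e : ∀ l : Fin 2 → ℤ, u l * hatFn (latpt ε k 0 / ε - l 0) (latpt ε k 1 / ε - l 1) =
      if l = k then u l else 0 := by
    intro l
    have := hatFn_lower le_rfl le_rfl (by norm_num) (l 0 - k 0) (l 1 - k 1)
    simp only [latpt, toV2, WithLp.equiv_symm_apply, mul_div_cancel_left₀ _ hε.ne']
    push_cast at this
    rw [zero_sub, neg_sub, zero_sub, neg_sub] at this
    rw [this, sub_zero, sub_zero, ite_self, ite_self, add_zero, add_zero, mul_ite, mul_one,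
      mul_zero]
    exact if_congr (by simp [funext_iff, Fin.forall_fin_two, sub_eq_zero]) rfl rfl
  simp only [nodalInterp, e, Finset.sum_ite_eq', hk, if_true]

theorem measurableSet_latticeTriangle (ε : ℝ) (b : Bool) (n : Fin 2 → ℤ) :
    MeasurableSet (latticeTriangle ε b n) :=
  (isCompact_latticeTriangle ε b n).isClosed.measurableSet

theorem intervalIntegrable_indicator_line {T : Set (EuclideanSpace ℝ (Fin 2))}
    (hT : MeasurableSet T) (v w : EuclideanSpace ℝ (Fin 2)) :
    IntervalIntegrable (fun t : ℝ =>
      T.indicator (1 : EuclideanSpace ℝ (Fin 2) → ℝ) (t • v + w)) volume 0 1 := by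
  rw [intervalIntegrable_iff]
  have hm : Measurable fun t : ℝ => t • v + w := by fun_prop
  refine Measure.integrableOn_of_bounded (M := 1) (by simp)
    ((measurable_one.indicator hT).comp hm).aestronglyMeasurable (ae_of_all _ fun t => ?_)
  simp only [Set.indicator, Pi.one_apply]
  split_ifs <;> simp

/-- The difference of an interpolant across a bond that avoids the vertices of the triangulation,
as the integral of its directional derivative. -/
theorem integral_indicator_latticeTriangle {ε : ℝ} (hε : 0 < ε) {M : ℤ} (u : (Fin 2 → ℤ) → ℝ)
    (v : EuclideanSpace ℝ (Fin 2)) (hv : ∀ i, |v i| ≤ ε * (M - 2))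
    {w : EuclideanSpace ℝ (Fin 2)} (hw : w ∈ offGrid ε) (hw1 : ∀ i, |w i| ≤ ε) :
    ∫ t in (0 : ℝ)..1, ∑ n ∈ latticeBox M, ∑ b, (latticeTriangle ε b n).indicator 1 (t • v + w) *
        (v 0 / ε * nodalDiff u b n 0 + v 1 / ε * nodalDiff u b n 1) =
      nodalInterp ε (latticeBox (M + 2)) u (v + w) - nodalInterp ε (latticeBox (M + 2)) u w := by
  have hline : Continuous fun t : ℝ => t • v + w := by fun_prop
  have key := integral_eq_of_hasDerivAt_off_countable
    (fun t : ℝ => nodalInterp ε (latticeBox (M + 2)) u (t • v + w))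
    (fun t : ℝ => ∑ n ∈ latticeBox M, ∑ b, (latticeTriangle ε b n).indicator 1 (t • v + w) *
        (v 0 / ε * nodalDiff u b n 0 + v 1 / ε * nodalDiff u b n 1)) (a := 0) (b := 1)
    (countable_smul_add_notMem_offGrid v hw)
    ((continuous_nodalInterp _ _ _).comp hline).continuousOn ?_ ?_
  · simpa using key
  · rintro t ⟨ht, hgrid⟩
    simp only [Set.mem_ofPred_eq, not_not] at hgrid
    obtain ⟨b, n, hp⟩ := exists_mem_openLatticeTriangle hε hgrid
    have hn : n ∈ latticeBox M := by
      rw [mem_latticeBox]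
      intro i
      have h1 := coord_mem_of_mem_latticeTriangle hε (openLatticeTriangle_subset hε b n hp) i
      have h2 : |(t • v + w) i| ≤ ε * (M - 1) := by
        rw [min_eq_left zero_le_one, max_eq_right zero_le_one] at ht
        calc |(t • v + w) i| ≤ |t * v i| + |w i| := abs_add_le _ _
          _ ≤ 1 * |v i| + |w i| := by
            rw [abs_mul, abs_of_pos ht.1]
            gcongr
            exact ht.2.le
          _ ≤ ε * (M - 1) := by linarith [hv i, hw1 i]
      rw [abs_le] at h2
      have h3 : (n i : ℝ) ≤ M - 1 := le_of_mul_le_mul_left (h1.1.trans h2.2) hε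
      have h4 : (-(M - 1) : ℝ) ≤ n i + 1 :=
        le_of_mul_le_mul_left (by linarith [h1.2, h2.1]) hε
      have h5 : (-M : ℝ) ≤ n i := by linarith
      have h6 : (n i : ℝ) ≤ M := by linarith
      exact ⟨by exact_mod_cast h5, by exact_mod_cast h6⟩
    obtain ⟨c, hc⟩ := exists_nodalInterp_eq_affine hε u b hn
    have hsum : ∑ n' ∈ latticeBox M, ∑ b', (latticeTriangle ε b' n').indicator 1 (t • v + w) *
        (v 0 / ε * nodalDiff u b' n' 0 + v 1 / ε * nodalDiff u b' n' 1) =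
        v 0 / ε * nodalDiff u b n 0 + v 1 / ε * nodalDiff u b n 1 := by
      rw [Finset.sum_eq_single_of_mem n hn, Finset.sum_eq_single_of_mem b (Finset.mem_univ b),
        Set.indicator_of_mem (openLatticeTriangle_subset hε b n hp), Pi.one_apply, one_mul]
      · intro b' _ hb
        rw [Set.indicator_of_notMem, zero_mul]
        exact fun h => hb (eq_of_mem_openLatticeTriangle hε hp h).1
      · intro n' _ hn'
        refine Finset.sum_eq_zero fun b' _ => ?_
        rw [Set.indicator_of_notMem, zero_mul]
        exact fun h => hn' (eq_of_mem_openLatticeTriangle hε hp h).2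
    simp only [hsum]
    have haff : HasDerivAt (fun s : ℝ => c + (s * v 0 + w 0) / ε * nodalDiff u b n 0
        + (s * v 1 + w 1) / ε * nodalDiff u b n 1)
        (v 0 / ε * nodalDiff u b n 0 + v 1 / ε * nodalDiff u b n 1) t := by
      have hlin : ∀ i, HasDerivAt (fun s : ℝ => (s * v i + w i) / ε * nodalDiff u b n i)
          (v i / ε * nodalDiff u b n i) t := fun i => by
        simpa using ((((hasDerivAt_id t).mul_const (v i)).add_const (w i)).div_const ε).mul_const
          (nodalDiff u b n i)
      exact ((hlin 0).const_add c).add (hlin 1)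
    refine haff.congr_of_eventuallyEq ?_
    filter_upwards [hline.continuousAt.preimage_mem_nhds
      ((isOpen_openLatticeTriangle ε b n).mem_nhds hp)] with s hs
    simpa using hc _ (openLatticeTriangle_subset hε b n hs)
  · simp only [intervalIntegrable_iff]
    exact integrable_finsetSum _ fun n _ => integrable_finsetSum _ fun b _ =>
      (intervalIntegrable_iff.1 (intervalIntegrable_indicator_line
        (measurableSet_latticeTriangle ε b n) v w)).mul_const _

theorem volume_inter_closedBall_eq_integral {T : Set (EuclideanSpace ℝ (Fin 2))}
    (hT : MeasurableSet T) (p : EuclideanSpace ℝ (Fin 2)) (s : ℝ) :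
    (volume (T ∩ Metric.closedBall p s)).toReal =
      ∫ w in Metric.closedBall (0 : EuclideanSpace ℝ (Fin 2)) s, T.indicator 1 (p + w) := by
  have h1 : ∀ w, T.indicator (1 : EuclideanSpace ℝ (Fin 2) → ℝ) (p + w) =
      ((p + ·) ⁻¹' T).indicator 1 w := fun w => rfl
  have hm : MeasurableSet ((p + ·) ⁻¹' T) := (measurable_const_add p) hT
  simp_rw [h1]
  rw [integral_indicator_one hm, measureReal_restrict_apply hm, Measure.real,
    ← measure_preimage_add volume p]
  congr 2
  ext w
  simp

/-- Continuous functions are the limits of their averages over balls. -/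
theorem tendsto_integral_closedBall_div {E : Type*} [NormedAddCommGroup E] [NormedSpace ℝ E]
    [FiniteDimensional ℝ E] [MeasurableSpace E] [BorelSpace E] (μ : Measure E)
    [μ.IsAddHaarMeasure] {F : E → ℝ} (hF : Continuous F) (x : E) :
    Tendsto (fun s : ℝ => (∫ w in Metric.closedBall x s, F w ∂μ) / (μ (Metric.closedBall x s)).toReal)
      (nhdsWithin 0 (Set.Ioi 0)) (nhds (F x)) := by
  rw [Metric.tendsto_nhdsWithin_nhds]
  intro δ hδ
  obtain ⟨η, hη, hF'⟩ := Metric.continuous_iff.1 hF x (δ / 2) (half_pos hδ)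
  refine ⟨η, hη, fun {s} hs hsη => ?_⟩
  have hs : 0 < s := hs
  rw [Real.dist_eq, sub_zero, abs_of_pos hs] at hsη
  have hfin : μ (Metric.closedBall x s) < ⊤ := measure_closedBall_lt_top
  have hpos : 0 < (μ (Metric.closedBall x s)).toReal :=
    ENNReal.toReal_pos (Metric.measure_closedBall_pos μ x hs).ne' hfin.ne
  have hint : IntegrableOn F (Metric.closedBall x s) μ :=
    hF.continuousOn.integrableOn_compact (isCompact_closedBall x s)
  have hb : ‖∫ w in Metric.closedBall x s, (F w - F x) ∂μ‖ ≤
      δ / 2 * μ.real (Metric.closedBall x s) := by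
    refine norm_setIntegral_le_of_norm_le_const hfin fun w hw => ?_
    exact (hF' w ((Metric.mem_closedBall.1 hw).trans_lt hsη)).le
  rw [integral_sub hint (integrableOn_const hfin.ne), setIntegral_const] at hb
  rw [Real.dist_eq, div_sub' hpos.ne', abs_div, abs_of_pos hpos, div_lt_iff₀ hpos]
  simp only [Measure.real, smul_eq_mul, Real.norm_eq_abs] at hb
  exact hb.trans_lt (by nlinarith)

theorem IsDensityFn.eq_zero_of_notMem {T : Set (EuclideanSpace ℝ (Fin 2))}
    {χ : EuclideanSpace ℝ (Fin 2) → ℝ} (hχ : IsDensityFn T χ) (hT : IsClosed T)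
    {p : EuclideanSpace ℝ (Fin 2)} (hp : p ∉ T) : χ p = 0 := by
  refine tendsto_nhds_unique (hχ p) (tendsto_const_nhds.congr' ?_)
  obtain ⟨η, hη, hball⟩ := Metric.isOpen_iff.1 hT.isOpen_compl p hp
  filter_upwards [Ioo_mem_nhdsGT hη] with s hs
  have : T ∩ Metric.closedBall p s = ∅ := by
    rw [← Set.disjoint_iff_inter_eq_empty, Set.disjoint_right]
    exact fun q hq => hball (Metric.closedBall_subset_ball hs.2 hq)
  simp [this]

theorem IsDensityFn.vadd_eq {T T' : Set (EuclideanSpace ℝ (Fin 2))}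
    {χ χ' : EuclideanSpace ℝ (Fin 2) → ℝ} (hχ : IsDensityFn T χ) (hχ' : IsDensityFn T' χ')
    {q : EuclideanSpace ℝ (Fin 2)} (hT : ∀ p, q + p ∈ T' ↔ p ∈ T)
    (p : EuclideanSpace ℝ (Fin 2)) : χ' (q + p) = χ p := by
  refine tendsto_nhds_unique (hχ' (q + p)) ((hχ p).congr fun s => ?_)
  have h1 : volume (T ∩ Metric.closedBall p s) = volume (T' ∩ Metric.closedBall (q + p) s) := by
    rw [← measure_preimage_add volume q (T' ∩ _)]
    congr 1
    ext w
    simp [← hT, dist_eq_norm]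
  rw [h1, Measure.addHaar_closedBall_center volume p, Measure.addHaar_closedBall_center volume (q + p)]

theorem integrable_indicator_line {T : Set (EuclideanSpace ℝ (Fin 2))} (hT : MeasurableSet T)
    (v : EuclideanSpace ℝ (Fin 2)) (s : ℝ) :
    Integrable (Function.uncurry fun (t : ℝ) (w : EuclideanSpace ℝ (Fin 2)) =>
        T.indicator (1 : EuclideanSpace ℝ (Fin 2) → ℝ) (t • v + w))
      ((volume.restrict (Set.uIoc 0 1)).prod (volume.restrict (Metric.closedBall 0 s))) := by
  have : IsFiniteMeasure (volume.restrict
      (Metric.closedBall (0 : EuclideanSpace ℝ (Fin 2)) s)) :=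
    isFiniteMeasure_restrict.2 measure_closedBall_lt_top.ne
  have : IsFiniteMeasure (volume.restrict (Set.uIoc (0 : ℝ) 1)) :=
    isFiniteMeasure_restrict.2 (by simp)
  refine Integrable.of_bound (C := 1) ?_ (ae_of_all _ ?_)
  · have hm : Measurable fun x : ℝ × EuclideanSpace ℝ (Fin 2) => x.1 • v + x.2 := by fun_prop
    exact ((measurable_one.indicator hT).comp hm).aestronglyMeasurable
  · rintro ⟨t, w⟩
    simp only [Function.uncurry, Set.indicator, Pi.one_apply]
    split_ifs <;> simp

theorem IsDensityFn.tendsto_integral_line {T : Set (EuclideanSpace ℝ (Fin 2))}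
    {χ : EuclideanSpace ℝ (Fin 2) → ℝ} (hχ : IsDensityFn T χ) (hT : MeasurableSet T)
    (v : EuclideanSpace ℝ (Fin 2)) :
    Tendsto (fun s : ℝ => (∫ t in (0 : ℝ)..1, ∫ w in Metric.closedBall
        (0 : EuclideanSpace ℝ (Fin 2)) s, T.indicator 1 (t • v + w)) /
        (volume (Metric.closedBall (0 : EuclideanSpace ℝ (Fin 2)) s)).toReal)
      (nhdsWithin 0 (Set.Ioi 0)) (nhds (∫ t in (0 : ℝ)..1, χ (t • v))) := by
  simp_rw [← intervalIntegral.integral_div]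
  refine intervalIntegral.tendsto_integral_filter_of_dominated_convergence (fun _ => 1) ?_ ?_ ?_ ?_
  · exact Eventually.of_forall fun s =>
      ((integrable_indicator_line hT v s).integral_prod_left.div_const _).aestronglyMeasurable
  · refine Eventually.of_forall fun s => ae_of_all _ fun t _ => ?_
    rw [← volume_inter_closedBall_eq_integral hT, ← Measure.addHaar_closedBall_center volume (t • v),
      Real.norm_eq_abs, abs_of_nonneg (by positivity)]
    refine div_le_one_of_le₀ ?_ ENNReal.toReal_nonneg
    exact ENNReal.toReal_mono measure_closedBall_lt_top.ne (measure_mono Set.inter_subset_right)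
  · exact intervalIntegrable_const
  · refine ae_of_all _ fun t _ => (hχ (t • v)).congr fun s => ?_
    rw [← volume_inter_closedBall_eq_integral hT, ← Measure.addHaar_closedBall_center volume (t • v)]

theorem sum_integral_density_line {ε : ℝ} (hε : 0 < ε)
    {χ : Bool → (Fin 2 → ℤ) → EuclideanSpace ℝ (Fin 2) → ℝ}
    (hχ : ∀ b n, IsDensityFn (latticeTriangle ε b n) (χ b n)) {M : ℤ} (u : (Fin 2 → ℤ) → ℝ)
    (v : EuclideanSpace ℝ (Fin 2)) (hv : ∀ i, |v i| ≤ ε * (M - 2)) :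
    ∑ n ∈ latticeBox M, ∑ b, (∫ t in (0 : ℝ)..1, χ b n (t • v)) *
        (v 0 / ε * nodalDiff u b n 0 + v 1 / ε * nodalDiff u b n 1) =
      nodalInterp ε (latticeBox (M + 2)) u v - nodalInterp ε (latticeBox (M + 2)) u 0 := by
  have hcont : Continuous fun w => nodalInterp ε (latticeBox (M + 2)) u (v + w)
      - nodalInterp ε (latticeBox (M + 2)) u w :=
    ((continuous_nodalInterp _ _ _).comp (by fun_prop)).sub (continuous_nodalInterp _ _ _)
  have h1 := tendsto_finsetSum (latticeBox M) fun n _ =>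
    tendsto_finsetSum Finset.univ fun b _ => ((hχ b n).tendsto_integral_line
      (measurableSet_latticeTriangle ε b n) v).mul_const
        (v 0 / ε * nodalDiff u b n 0 + v 1 / ε * nodalDiff u b n 1)
  have h2 := tendsto_integral_closedBall_div volume hcont 0
  rw [add_zero] at h2
  refine tendsto_nhds_unique h1 (h2.congr' ?_)
  filter_upwards [Ioo_mem_nhdsGT hε] with s hs
  have hswap : ∀ b n, ∫ t in (0 : ℝ)..1, ∫ w in Metric.closedBall
        (0 : EuclideanSpace ℝ (Fin 2)) s, (latticeTriangle ε b n).indicator 1 (t • v + w) =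
      ∫ w in Metric.closedBall (0 : EuclideanSpace ℝ (Fin 2)) s, ∫ t in (0 : ℝ)..1,
        (latticeTriangle ε b n).indicator 1 (t • v + w) := fun b n =>
    intervalIntegral_integral_swap
      (integrable_indicator_line (measurableSet_latticeTriangle ε b n) v s)
  have hint : ∀ b n, Integrable (fun w => ∫ t in (0 : ℝ)..1,
      (latticeTriangle ε b n).indicator (1 : EuclideanSpace ℝ (Fin 2) → ℝ) (t • v + w))
      (volume.restrict (Metric.closedBall 0 s)) := fun b n => by
    simpa [intervalIntegral.integral_of_le zero_le_one, Set.uIoc_of_le (zero_le_one' ℝ)] using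
      (integrable_indicator_line (measurableSet_latticeTriangle ε b n) v s).integral_prod_right
  simp_rw [hswap, div_mul_eq_mul_div, ← Finset.sum_div]
  congr 1
  simp_rw [← integral_mul_const]
  rw [Finset.sum_congr rfl fun n _ => (integral_finsetSum _ fun b _ =>
      (hint b n).mul_const _).symm, ← integral_finsetSum _ fun n _ =>
        integrable_finsetSum _ fun b _ => (hint b n).mul_const _]
  refine setIntegral_congr_ae Metric.isClosed_closedBall.measurableSet ?_
  filter_upwards [ae_mem_offGrid ε] with w hw hws
  rw [← integral_indicator_latticeTriangle hε u v hv hw fun i => ?_,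
    intervalIntegral.integral_finsetSum]
  · refine Finset.sum_congr rfl fun n _ => ?_
    rw [intervalIntegral.integral_finsetSum]
    · simp_rw [intervalIntegral.integral_mul_const, div_mul_eq_mul_div]
    · exact fun b _ => (intervalIntegrable_indicator_line
        (measurableSet_latticeTriangle ε b n) v w).mul_const _
  · intro n _
    simp only [intervalIntegrable_iff]
    exact integrable_finsetSum _ fun b _ => (intervalIntegrable_iff.1
      (intervalIntegrable_indicator_line (measurableSet_latticeTriangle ε b n) v w)).mul_const _
  · rw [mem_closedBall_zero_iff] at hws
    exact (PiLp.norm_apply_le w i).trans (hws.trans hs.2.le)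

theorem smul_zvec (ε : ℝ) (r : Fin 2 → ℤ) : ε • zvec r = latpt ε r := by
  ext i
  simp [zvec, latpt, toV2]

theorem latpt_zero (ε : ℝ) : latpt ε 0 = 0 := by
  ext i
  simp [latpt, toV2]

section Bonds

variable {ε : ℝ} {χ : Bool → (Fin 2 → ℤ) → EuclideanSpace ℝ (Fin 2) → ℝ}

theorem bondInt_eq_bondInt_zero (hε : 0 < ε)
    (hχ : ∀ b n, IsDensityFn (latticeTriangle ε b n) (χ b n)) (b : Bool) (n x r : Fin 2 → ℤ) :
    bondInt ε (χ b n) x r = bondInt ε (χ b (n - x)) 0 r := by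
  have h := (hχ b (n - x)).vadd_eq (hχ b (x + (n - x)))
    fun p => latpt_add_mem_latticeTriangle hε b (n - x) x p
  rw [add_sub_cancel] at h
  simp only [bondInt, h, latpt_zero, zero_add]

/-- A bound on the indices of the cells that meet the bond from `0` to `r`. -/
def bondRadius (r : Fin 2 → ℤ) : ℤ := |r 0| + |r 1| + 2

theorem abs_latpt_apply_le (hε : 0 < ε) (r : Fin 2 → ℤ) (i : Fin 2) :
    |latpt ε r i| ≤ ε * (bondRadius r - 2) := by
  simp only [latpt, toV2, WithLp.equiv_symm_apply, bondRadius, abs_mul, abs_of_pos hε]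
  refine mul_le_mul_of_nonneg_left ?_ hε.le
  push_cast
  have := abs_nonneg (r 0 : ℝ)
  have := abs_nonneg (r 1 : ℝ)
  fin_cases i <;> dsimp <;> linarith

theorem bondInt_zero_eq_zero (hε : 0 < ε)
    (hχ : ∀ b n, IsDensityFn (latticeTriangle ε b n) (χ b n)) (b : Bool) {n r : Fin 2 → ℤ}
    (hn : n ∉ latticeBox (bondRadius r)) : bondInt ε (χ b n) 0 r = 0 := by
  rw [bondInt, latpt_zero, smul_zvec]
  refine intervalIntegral.integral_zero_ae (ae_of_all _ fun t ht => ?_)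
  refine (hχ b n).eq_zero_of_notMem (isCompact_latticeTriangle ε b n).isClosed fun hp => hn ?_
  rw [Set.uIoc_of_le zero_le_one] at ht
  rw [zero_add] at hp
  rw [mem_latticeBox]
  intro i
  obtain ⟨h1, h2⟩ := coord_mem_of_mem_latticeTriangle hε hp i
  have h3 : |(t • latpt ε r) i| ≤ ε * (bondRadius r - 2) := by
    rw [PiLp.smul_apply, smul_eq_mul, abs_mul, abs_of_pos ht.1]
    exact (mul_le_of_le_one_left (abs_nonneg _) ht.2).trans (abs_latpt_apply_le hε r i)
  rw [abs_le] at h3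
  have h4 : (n i : ℝ) ≤ bondRadius r - 2 := le_of_mul_le_mul_left (h1.trans h3.2) hε
  have h5 : (-(bondRadius r - 2) : ℝ) ≤ n i + 1 :=
    le_of_mul_le_mul_left (by linarith [h3.1]) hε
  have h6 : (-bondRadius r : ℝ) ≤ n i := by linarith
  have h7 : (n i : ℝ) ≤ bondRadius r := by linarith
  exact ⟨by exact_mod_cast h6, by exact_mod_cast h7⟩

theorem nodalDiff_comp_add (u : (Fin 2 → ℤ) → ℝ) (b : Bool) (x n : Fin 2 → ℤ) (j : Fin 2) :
    nodalDiff (fun k => u (x + k)) b n j = nodalDiff u b (x + n) j := by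
  cases b <;> simp [nodalDiff, add_assoc]

theorem sum_bondInt_mul_nodalDiff (hε : 0 < ε)
    (hχ : ∀ b n, IsDensityFn (latticeTriangle ε b n) (χ b n)) (u : (Fin 2 → ℤ) → ℝ)
    (x r : Fin 2 → ℤ) :
    ∑ k ∈ latticeBox (bondRadius r), ∑ b, bondInt ε (χ b k) 0 r *
      ∑ j, r j * nodalDiff u b (x + k) j = u (x + r) - u x := by
  have h := sum_integral_density_line hε hχ (fun k => u (x + k)) (latpt ε r)
    (abs_latpt_apply_le hε r)
  have hr : r ∈ latticeBox (bondRadius r + 2) := by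
    rw [mem_latticeBox, bondRadius]
    have := abs_nonneg (r 0)
    have := abs_nonneg (r 1)
    intro i
    rw [← abs_le]
    fin_cases i <;> dsimp <;> linarith
  have h0 : (0 : Fin 2 → ℤ) ∈ latticeBox (bondRadius r + 2) := by
    rw [mem_latticeBox, bondRadius]
    have := abs_nonneg (r 0)
    have := abs_nonneg (r 1)
    intro i
    constructor <;> simp only [Pi.zero_apply] <;> linarith
  rw [← latpt_zero ε] at h
  rw [nodalInterp_latpt hε _ hr, nodalInterp_latpt hε _ h0, add_zero] at h
  rw [← h]
  have hdiv : ∀ i, latpt ε r i / ε = r i := fun i => by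
    simp [latpt, toV2, mul_div_cancel_left₀ _ hε.ne']
  simp only [bondInt, latpt_zero, zero_add, smul_zvec, hdiv, nodalDiff_comp_add, Fin.sum_univ_two]

theorem frob_outer (a : EuclideanSpace ℝ (Fin 2)) (r : Fin 2 → ℤ) (B : Mat2) :
    frob (outer a r) B = ∑ i, a i * ∑ j, r j * B i j := by
  simp only [frob, outer, WithLp.equiv_apply, Finset.mul_sum, mul_assoc]

theorem frob_sum_left {ι : Type*} (s : Finset ι) (f : ι → Mat2) (B : Mat2) :
    frob (∑ k ∈ s, f k) B = ∑ k ∈ s, frob (f k) B := by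
  simp only [frob, Finset.sum_apply, Finset.sum_mul, Fin.sum_univ_two, Finset.sum_add_distrib]

theorem frob_smul_left (c : ℝ) (A B : Mat2) : frob (c • A) B = c * frob A B := by
  simp only [frob, Pi.smul_apply, smul_eq_mul, Finset.mul_sum, mul_assoc]

theorem area_mul_frob_Sa (hε : 0 < ε)
    (hχ : ∀ b n, IsDensityFn (latticeTriangle ε b n) (χ b n)) (R : Finset (Fin 2 → ℤ))
    (DV : (R → EuclideanSpace ℝ (Fin 2)) → R → EuclideanSpace ℝ (Fin 2))
    (y : (Fin 2 → ℤ) → EuclideanSpace ℝ (Fin 2)) {area : ℝ} (harea : area ≠ 0)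
    (b : Bool) (n : Fin 2 → ℤ) (B : Mat2) :
    area * frob (Sa ε R DV y area (χ b n)) B = ε ^ 2 * ∑ r : R,
      ∑ k ∈ latticeBox (bondRadius r), bondInt ε (χ b k) 0 r *
        ∑ i, DV (fun s => fd2 ε s y (n - k)) r i * ∑ j, (r : Fin 2 → ℤ) j * B i j := by
  have htsum : ∀ r : R, ∑' x : Fin 2 → ℤ, bondInt ε (χ b n) x r •
      outer (DV (fun s => fd2 ε s y x) r) r = ∑ k ∈ latticeBox (bondRadius r),
        bondInt ε (χ b k) 0 r • outer (DV (fun s => fd2 ε s y (n - k)) r) r := by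
    intro r
    rw [← (Equiv.subLeft n).tsum_eq, tsum_eq_sum]
    · refine Finset.sum_congr rfl fun k _ => ?_
      rw [Equiv.subLeft_apply, bondInt_eq_bondInt_zero hε hχ, sub_sub_cancel]
    · intro k hk
      rw [Equiv.subLeft_apply, bondInt_eq_bondInt_zero hε hχ, sub_sub_cancel,
        bondInt_zero_eq_zero hε hχ b hk, zero_smul]
  simp only [Sa, htsum, frob_sum_left, frob_smul_left, frob_outer, Finset.mul_sum]
  refine Finset.sum_congr rfl fun r _ => Finset.sum_congr rfl fun k _ =>
    Finset.sum_congr rfl fun i _ => Finset.sum_congr rfl fun j _ => ?_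
  field_simp

end Bonds

theorem sum_range_add_eq_of_periodic {g : ℤ → ℝ} {P : ℕ} (hg : ∀ x, g (x + P) = g x) (a b : ℤ) :
    ∑ i ∈ Finset.range P, g (a + i) = ∑ i ∈ Finset.range P, g (b + i) := by
  have step : ∀ a : ℤ, ∑ i ∈ Finset.range P, g (a + 1 + i) = ∑ i ∈ Finset.range P, g (a + i) := by
    intro a
    have h1 := Finset.sum_range_succ (fun i : ℕ => g (a + i)) P
    rw [Finset.sum_range_succ'] at h1
    simp only [hg, Nat.cast_zero, add_zero, Nat.cast_add, Nat.cast_one] at h1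
    rw [← add_right_cancel h1]
    exact Finset.sum_congr rfl fun i _ => by rw [add_assoc, add_comm 1]
  have zero : ∀ a : ℤ, ∑ i ∈ Finset.range P, g (a + i) = ∑ i ∈ Finset.range P, g (0 + i) := by
    intro a
    induction a using Int.induction_on with
    | zero => rfl
    | succ k ih => rw [step, ih]
    | pred k ih => rw [← ih, ← step (-(k : ℤ) - 1), sub_add_cancel]
  rw [zero a, zero b]

theorem sum_Icc_eq_of_periodic {g : ℤ → ℝ} {P : ℕ} (hg : ∀ x, g (x + P) = g x) {a a' b b' : ℤ}
    (ha : a' = a + P - 1) (hb : b' = b + P - 1) (c : ℤ) :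
    ∑ x ∈ Finset.Icc a a', g x = ∑ x ∈ Finset.Icc b b', g (x + c) := by
  have h : ∀ (f : ℤ → ℝ) (a a' : ℤ), a' = a + P - 1 →
      ∑ x ∈ Finset.Icc a a', f x = ∑ i ∈ Finset.range P, f (a + i) := by
    intro f a a' ha
    refine Finset.sum_nbij' (fun x => (x - a).toNat) (fun i => a + i) ?_ ?_ ?_ ?_ ?_
    · intro x hx
      rw [Finset.mem_Icc] at hx
      rw [Finset.mem_range]
      omega
    · intro i hi
      rw [Finset.mem_range] at hi
      rw [Finset.mem_Icc]
      omega
    · intro x hx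
      rw [Finset.mem_Icc] at hx
      omega
    · intro i hi
      omega
    · intro x hx
      rw [Finset.mem_Icc] at hx
      congr 1
      omega
  rw [h _ _ _ ha, h _ _ _ hb, sum_range_add_eq_of_periodic hg a (b + c)]
  exact Finset.sum_congr rfl fun i _ => by rw [add_right_comm]

theorem sum_piFinset_fin_two (s : Finset ℤ) (h : (Fin 2 → ℤ) → ℝ) :
    ∑ x ∈ Fintype.piFinset (fun _ : Fin 2 => s), h x = ∑ i ∈ s, ∑ j ∈ s, h ![i, j] := by
  rw [← Finset.sum_product']
  refine Finset.sum_nbij' (fun x => (x 0, x 1)) (fun p => ![p.1, p.2]) ?_ ?_ ?_ ?_ ?_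
  · intro x hx
    rw [Fintype.mem_piFinset] at hx
    exact Finset.mem_product.2 ⟨hx 0, hx 1⟩
  · intro p hp
    rw [Finset.mem_product] at hp
    simpa [Fin.forall_fin_two] using hp
  · intro x _
    ext i
    fin_cases i <;> rfl
  · intro p _
    rfl
  · intro x _
    congr 1
    ext i
    fin_cases i <;> rfl

theorem sum_base2_eq_sum_cell2 {N : ℕ} {h : (Fin 2 → ℤ) → ℝ}
    (hh : ∀ x ξ : Fin 2 → ℤ, h (x + (2 * N : ℤ) • ξ) = h x) (k : Fin 2 → ℤ) :
    ∑ n ∈ base2 N, h n = ∑ x ∈ cell2 N, h (x + k) := by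
  rw [base2, cell2, sum_piFinset_fin_two, sum_piFinset_fin_two]
  have h0 : ∀ i j : ℤ, h ![i + (2 * N : ℕ), j] = h ![i, j] := fun i j => by
    rw [← hh ![i, j] ![1, 0]]
    simp
  have h1 : ∀ i j : ℤ, h ![i, j + (2 * N : ℕ)] = h ![i, j] := fun i j => by
    rw [← hh ![i, j] ![0, 1]]
    simp
  have e : ∀ i j : ℤ, ![i, j] + k = ![i + k 0, j + k 1] := fun i j => by
    ext l
    fin_cases l <;> rfl
  simp_rw [e]
  rw [sum_Icc_eq_of_periodic (g := fun i => ∑ j ∈ Finset.Icc (-(N : ℤ)) (N - 1), h ![i, j])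
    (P := 2 * N) (b := -(N : ℤ) + 1) (b' := N) (fun i => Finset.sum_congr rfl fun j _ => h0 i j)
    (by push_cast; ring) (by push_cast; ring) (k 0)]
  exact Finset.sum_congr rfl fun i _ => sum_Icc_eq_of_periodic (h1 _) (by push_cast; ring)
    (by push_cast; ring) (k 1)

theorem InY.fd2_add_period {N : ℕ} {y : (Fin 2 → ℤ) → EuclideanSpace ℝ (Fin 2)} (hy : InY N y)
    (ε : ℝ) (r x ξ : Fin 2 → ℤ) : fd2 ε r y (x + (2 * N : ℤ) • ξ) = fd2 ε r y x := by
  obtain ⟨A, hA⟩ := hy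
  rw [fd2, fd2, add_right_comm, hA, hA, add_sub_add_right_eq_sub]

theorem InY.nodalDiff_add_period {N : ℕ} {z : (Fin 2 → ℤ) → EuclideanSpace ℝ (Fin 2)}
    (hz : InY N z) (i : Fin 2) (b : Bool) (n ξ : Fin 2 → ℤ) (j : Fin 2) :
    nodalDiff (fun k => z k i) b (n + (2 * N : ℤ) • ξ) j = nodalDiff (fun k => z k i) b n j := by
  obtain ⟨A, hA⟩ := hz
  cases b <;>
    simp only [nodalDiff, add_right_comm n ((2 * N : ℤ) • ξ), add_right_comm _ ((2 * N : ℤ) • ξ),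
      hA, PiLp.add_apply, add_sub_add_right_eq_sub]

/-- Atomistic stress representation of the first variation:
`ε² ∑_{x∈𝓛} ∑_{r∈ℛ} ∂_r V(D_ℛ y(x)) · D_r z(x) = ∑_{T∈𝒯_ε} |T| Σ_a(y;T) : ∇z(T)`. -/
theorem stmt_12 (N : ℕ) (hN : 1 ≤ N)
    (R : Finset (Fin 2 → ℤ)) (hR : (0 : Fin 2 → ℤ) ∉ R)
    (V : (R → EuclideanSpace ℝ (Fin 2)) → ℝ) (hV : ContDiff ℝ 1 V)
    (DV : (R → EuclideanSpace ℝ (Fin 2)) → R → EuclideanSpace ℝ (Fin 2))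
    (hDV : ∀ (g : R → EuclideanSpace ℝ (Fin 2)) (r : R) (a : EuclideanSpace ℝ (Fin 2)),
      ⟪DV g r, a⟫ = fderiv ℝ V g (Pi.single r a))
    (y z : (Fin 2 → ℤ) → EuclideanSpace ℝ (Fin 2)) (hy : InY N y) (hz : InY N z)
    (χlo χup : (Fin 2 → ℤ) → EuclideanSpace ℝ (Fin 2) → ℝ)
    (hχlo : ∀ x : Fin 2 → ℤ, IsDensityFn (Tlo (1 / (N : ℝ)) x) (χlo x))
    (hχup : ∀ x : Fin 2 → ℤ, IsDensityFn (Tup (1 / (N : ℝ)) x) (χup x)) :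
    (1 / (N : ℝ)) ^ 2 * ∑ x ∈ cell2 N, ∑ r : R,
        ⟪DV (fun s => fd2 (1 / (N : ℝ)) (↑s) y x) r, fd2 (1 / (N : ℝ)) (↑r) z x⟫
    = ∑ x ∈ base2 N,
        ((volume (Tlo (1 / (N : ℝ)) x)).toReal
            * frob (Sa (1 / (N : ℝ)) R DV y (volume (Tlo (1 / (N : ℝ)) x)).toReal (χlo x))
                (gradLo (1 / (N : ℝ)) z x)
          + (volume (Tup (1 / (N : ℝ)) x)).toReal
            * frob (Sa (1 / (N : ℝ)) R DV y (volume (Tup (1 / (N : ℝ)) x)).toReal (χup x))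
                (gradUp (1 / (N : ℝ)) z x)) := by
  have hε : (0 : ℝ) < 1 / N := by
    have : (0 : ℝ) < N := by exact_mod_cast hN
    positivity
  generalize (1 : ℝ) / N = ε at *
  let χ : Bool → (Fin 2 → ℤ) → EuclideanSpace ℝ (Fin 2) → ℝ := fun b => cond b χup χlo
  have hχ : ∀ b n, IsDensityFn (latticeTriangle ε b n) (χ b n) := by
    rintro (_ | _) n
    exacts [hχlo n, hχup n]
  have hlo := fun n : Fin 2 → ℤ => area_mul_frob_Sa hε hχ R DV y
    (volume_latticeTriangle_ne_zero hε false n) false n (gradLo ε z n)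
  have hup := fun n : Fin 2 → ℤ => area_mul_frob_Sa hε hχ R DV y
    (volume_latticeTriangle_ne_zero hε true n) true n (gradUp ε z n)
  have hglo : ∀ n i j, gradLo ε z n i j = ε⁻¹ * nodalDiff (fun k => z k i) false n j := by
    intro n i j
    simp [gradLo, fd2, nodalDiff]
  have hgup : ∀ n i j, gradUp ε z n i j = ε⁻¹ * nodalDiff (fun k => z k i) true n j := by
    intro n i j
    simp [gradUp, fd2, nodalDiff]
  simp only [hglo] at hlo
  simp only [hgup] at hup
  let G : (Fin 2 → ℤ) → R → EuclideanSpace ℝ (Fin 2) := fun x => DV fun s => fd2 ε s y x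
  let h : R → Bool → (Fin 2 → ℤ) → (Fin 2 → ℤ) → ℝ := fun r b k n =>
    ∑ i, G (n - k) r i * ∑ j, (r : Fin 2 → ℤ) j * (ε⁻¹ * nodalDiff (fun k => z k i) b n j)
  have hG : ∀ x ξ : Fin 2 → ℤ, G (x + (2 * N : ℤ) • ξ) = G x := fun x ξ =>
    congrArg DV (funext fun s => hy.fd2_add_period ε s x ξ)
  have hper : ∀ r b k n (ξ : Fin 2 → ℤ), h r b k (n + (2 * N : ℤ) • ξ) = h r b k n := by
    intro r b k n ξ
    simp only [h, add_sub_right_comm n, hG, hz.nodalDiff_add_period]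
  have hsum : ∀ r : R, ∑ k ∈ latticeBox (bondRadius r), ∑ b, bondInt ε (χ b k) 0 r *
      ∑ n ∈ base2 N, h r b k n = ∑ x ∈ cell2 N, ⟪G x r, fd2 ε r z x⟫ := by
    intro r
    simp_rw [fun b k => sum_base2_eq_sum_cell2 (hper r b k) k, Finset.mul_sum]
    simp_rw [Finset.sum_comm (t := cell2 N)]
    refine Finset.sum_congr rfl fun x _ => ?_
    have hfd : ∀ i, fd2 ε r z x i = ε⁻¹ * ∑ k ∈ latticeBox (bondRadius r), ∑ b,
        bondInt ε (χ b k) 0 r *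
          ∑ j, (r : Fin 2 → ℤ) j * nodalDiff (fun k => z k i) b (x + k) j := by
      intro i
      rw [sum_bondInt_mul_nodalDiff hε hχ]
      simp [fd2]
    simp only [h, add_sub_cancel_right, PiLp.inner_apply, hfd, RCLike.inner_apply, conj_trivial,
      Fin.sum_univ_two, Finset.mul_sum, Finset.sum_mul]
    rw [← Finset.sum_add_distrib]
    refine Finset.sum_congr rfl fun k _ => ?_
    simp only [Fintype.sum_bool]
    ring
  calc ε ^ 2 * ∑ x ∈ cell2 N, ∑ r : R, ⟪G x r, fd2 ε r z x⟫
      = ε ^ 2 * ∑ r : R, ∑ k ∈ latticeBox (bondRadius r), ∑ b, bondInt ε (χ b k) 0 r *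
          ∑ n ∈ base2 N, h r b k n := by
        rw [Finset.sum_comm]
        simp only [hsum]
    _ = ∑ n ∈ base2 N, ∑ b, ε ^ 2 * ∑ r : R, ∑ k ∈ latticeBox (bondRadius r),
          bondInt ε (χ b k) 0 r * h r b k n := by
        simp only [Finset.mul_sum, Fintype.sum_bool, Finset.sum_add_distrib, mul_add]
        exact congrArg₂ (· + ·)
          ((Finset.sum_congr rfl fun r _ => Finset.sum_comm).trans Finset.sum_comm)
          ((Finset.sum_congr rfl fun r _ => Finset.sum_comm).trans Finset.sum_comm)
    _ = _ := by
        refine Finset.sum_congr rfl fun n _ => ?_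
        rw [Fintype.sum_bool, add_comm]
        exact (congrArg₂ (· + ·) (hlo n) (hup n)).symm
end
end

section
/- (Patch test consistency of a nonlocal interface functional.) Assume N is even. Define the index sets 𝓛^i_{−,±} := { x ∈ 𝓛 : x₁ ≤ 0, x₂ = ±1/2 } and 𝓛^i_{+,±} := { x ∈ 𝓛 : x₁ > 0, x₂ = ±1/2 }, and the functional J(y) := |Σ_{x∈𝓛^i_{−,+}} D_{e₁}y(x)|² + |Σ_{x∈𝓛^i_{+,+}} D_{e₁}y(x)|² − |Σ_{x∈𝓛^i_{−,−}} D_{e₁}y(x)|² − |Σ_{x∈𝓛^i_{+,−}} D_{e₁}y(x)|², with |·| the Euclidean norm on ℝ². Then for every F ∈ ℝ^{2×2}: (i) J(y_F) = 0, and (ii) for every periodic displacement u ∈ 𝓤, the function t ↦ J(y_F + t u) is differentiable at t = 0 with derivative 0. -/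
open scoped BigOperators

noncomputable section

/-- `2ℤ²`-periodic displacements, in integer coordinates. -/
def LatPeriodic2 (N : ℕ) (u : (Fin 2 → ℤ) → EuclideanSpace ℝ (Fin 2)) : Prop :=
  ∀ x ξ : Fin 2 → ℤ, u (x + (2 * N : ℤ) • ξ) = u x

/-- Homogeneous deformation `y_F(x) = Fx` (lattice point `x` sits at `εx ∈ ℝ²`). -/
def yhom2 (N : ℕ) (F : Fin 2 → Fin 2 → ℝ) (x : Fin 2 → ℤ) : EuclideanSpace ℝ (Fin 2) :=
  toV2 fun i => ∑ j, F i j * ((1 / (N : ℝ)) * (x j : ℝ))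

/-- `𝓛^i_{−,+}` (with `N = 2M`): `x ∈ 𝓛` with `x₁ ≤ 0` and `x₂ = 1/2`, i.e. `x 1 = M`. -/
def Lmp (M : ℕ) : Finset (Fin 2 → ℤ) :=
  (cell2 (2 * M)).filter fun x => x 0 ≤ 0 ∧ x 1 = (M : ℤ)

def Lpp (M : ℕ) : Finset (Fin 2 → ℤ) :=
  (cell2 (2 * M)).filter fun x => 0 < x 0 ∧ x 1 = (M : ℤ)

def Lmm (M : ℕ) : Finset (Fin 2 → ℤ) :=
  (cell2 (2 * M)).filter fun x => x 0 ≤ 0 ∧ x 1 = -(M : ℤ)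

def Lpm (M : ℕ) : Finset (Fin 2 → ℤ) :=
  (cell2 (2 * M)).filter fun x => 0 < x 0 ∧ x 1 = -(M : ℤ)

/-- The nonlocal interface functional `J`. -/
def Jfun (M : ℕ) (y : (Fin 2 → ℤ) → EuclideanSpace ℝ (Fin 2)) : ℝ :=
  ‖∑ x ∈ Lmp M, fd2 (1 / (2 * M : ℝ)) (eint 0) y x‖ ^ 2
    + ‖∑ x ∈ Lpp M, fd2 (1 / (2 * M : ℝ)) (eint 0) y x‖ ^ 2
    - ‖∑ x ∈ Lmm M, fd2 (1 / (2 * M : ℝ)) (eint 0) y x‖ ^ 2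
    - ‖∑ x ∈ Lpm M, fd2 (1 / (2 * M : ℝ)) (eint 0) y x‖ ^ 2

/-- Row sums of horizontal differences telescope. -/
lemma sum_fd2_row (k : ℤ)
    (a : ℤ) (n : ℕ) (S : Finset (Fin 2 → ℤ))
    (hS : ∀ x : Fin 2 → ℤ, x ∈ S ↔ (a ≤ x 0 ∧ x 0 < a + n) ∧ x 1 = k)
    (ε : ℝ) (v : (Fin 2 → ℤ) → EuclideanSpace ℝ (Fin 2)) :
    ∑ x ∈ S, fd2 ε (eint 0) v x = ε⁻¹ • (v ![a + n, k] - v ![a, k]) := by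
  have h : ∑ x ∈ S, fd2 ε (eint 0) v x
      = ∑ i ∈ Finset.range n, fd2 ε (eint 0) v ![a + i, k] := by
    symm
    refine Finset.sum_bij (fun i _ => ![a + (i : ℤ), k]) ?_ ?_ ?_ ?_
    · intro i hi
      have := Finset.mem_range.1 hi
      simp [hS, this]
    · intro i _ j _ hij
      simpa using congrFun hij 0
    · intro x hx
      obtain ⟨⟨h1, h2⟩, h3⟩ := (hS x).1 hx
      refine ⟨(x 0 - a).toNat, Finset.mem_range.2 (by omega), ?_⟩
      ext i
      fin_cases i
      · simp; omega
      · simp [h3]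
    · intros; rfl
  have hs (i : ℕ) : (![a + i, k] : Fin 2 → ℤ) + eint 0 = ![a + (i + 1 : ℕ), k] := by
    ext j
    fin_cases j <;> simp [eint, add_assoc]
  rw [h]
  simp only [fd2, hs]
  rw [← Finset.smul_sum, Finset.sum_range_sub (fun i : ℕ => v ![a + (i : ℤ), k])]
  simp

/-- `J` evaluated through the endpoints of the four telescoping row sums. -/
lemma Jfun_eq (M : ℕ) (hM : 1 ≤ M) (v : (Fin 2 → ℤ) → EuclideanSpace ℝ (Fin 2)) :
    Jfun M v =
      ‖(1 / (2 * M : ℝ))⁻¹ • (v ![1, M] - v ![1 - 2 * M, M])‖ ^ 2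
      + ‖(1 / (2 * M : ℝ))⁻¹ • (v ![1 + 2 * M, M] - v ![1, M])‖ ^ 2
      - ‖(1 / (2 * M : ℝ))⁻¹ • (v ![1, -M] - v ![1 - 2 * M, -M])‖ ^ 2
      - ‖(1 / (2 * M : ℝ))⁻¹ • (v ![1 + 2 * M, -M] - v ![1, -M])‖ ^ 2 := by
  unfold Jfun
  rw [sum_fd2_row M (1 - 2 * M) (2 * M) (Lmp M), sum_fd2_row M 1 (2 * M) (Lpp M),
    sum_fd2_row (-M) (1 - 2 * M) (2 * M) (Lmm M), sum_fd2_row (-M) 1 (2 * M) (Lpm M)]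
  · push_cast
    simp only [sub_add_cancel]
  all_goals
    intro x
    simp only [Lmp, Lpp, Lmm, Lpm, cell2, Finset.mem_filter, Fintype.mem_piFinset,
      Fin.forall_fin_two, Finset.mem_Icc]
    push_cast
    omega

/-- Horizontal increments of a homogeneous deformation depend only on the step length. -/
lemma yhom2_sub (N : ℕ) (F : Fin 2 → Fin 2 → ℝ) (a b k : ℤ) :
    yhom2 N F ![a, k] - yhom2 N F ![b, k]
      = toV2 fun i => F i 0 * ((1 / (N : ℝ)) * ((a - b : ℤ) : ℝ)) := by
  ext i
  simp [yhom2, toV2]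
  ring

/-- On homogeneous deformations perturbed by a periodic displacement, `J` is a pure quadratic
in the perturbation. -/
lemma Jfun_yhom2_add_smul (M : ℕ) (hM : 1 ≤ M) (F : Fin 2 → Fin 2 → ℝ)
    (u : (Fin 2 → ℤ) → EuclideanSpace ℝ (Fin 2)) (hu : LatPeriodic2 (2 * M) u) :
    ∃ c : ℝ, ∀ t : ℝ, Jfun M (yhom2 (2 * M) F + t • u) = c * t ^ 2 := by
  have hper (k : ℤ) : u ![1 + 2 * M, k] = u ![1 - 2 * M, k] := by
    rw [← hu ![1 - 2 * M, k] (eint 0)]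
    congr 1
    ext i
    fin_cases i
    · simp [eint]; ring
    · simp [eint]
  have key (A d : EuclideanSpace ℝ (Fin 2)) (s t : ℝ) :
      ‖s • (A + t • d)‖ ^ 2 + ‖s • (A - t • d)‖ ^ 2
        = 2 * s ^ 2 * (‖A‖ ^ 2 + t ^ 2 * ‖d‖ ^ 2) := by
    have := parallelogram_law_with_norm ℝ A (t • d)
    simp only [norm_smul, mul_pow, Real.norm_eq_abs, sq_abs] at this ⊢
    linear_combination s ^ 2 * this
  set A : EuclideanSpace ℝ (Fin 2) :=
    toV2 fun i => F i 0 * ((1 / ((2 * M : ℕ) : ℝ)) * ((2 * M : ℤ) : ℝ)) with hA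
  have hl (k : ℤ) (t : ℝ) : (yhom2 (2 * M) F + t • u) ![1, k]
      - (yhom2 (2 * M) F + t • u) ![1 - 2 * M, k]
      = A + t • (u ![1, k] - u ![1 - 2 * M, k]) := by
    have h := yhom2_sub (2 * M) F 1 (1 - 2 * M) k
    rw [sub_sub_cancel] at h
    rw [hA, ← h]
    simp only [Pi.add_apply, Pi.smul_apply, smul_sub]
    abel
  have hr (k : ℤ) (t : ℝ) : (yhom2 (2 * M) F + t • u) ![1 + 2 * M, k]
      - (yhom2 (2 * M) F + t • u) ![1, k]
      = A - t • (u ![1, k] - u ![1 - 2 * M, k]) := by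
    have h := yhom2_sub (2 * M) F (1 + 2 * M) 1 k
    rw [add_sub_cancel_left] at h
    rw [hA, ← h]
    simp only [Pi.add_apply, Pi.smul_apply, smul_sub, hper]
    abel
  refine ⟨2 * (1 / (2 * M : ℝ))⁻¹ ^ 2 * (‖u ![1, M] - u ![1 - 2 * M, M]‖ ^ 2
    - ‖u ![1, -M] - u ![1 - 2 * M, -M]‖ ^ 2), fun t => ?_⟩
  rw [Jfun_eq M hM, hl, hr, hl, hr]
  linear_combination key A (u ![1, M] - u ![1 - 2 * M, M]) (1 / (2 * M : ℝ))⁻¹ t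
    - key A (u ![1, -M] - u ![1 - 2 * M, -M]) (1 / (2 * M : ℝ))⁻¹ t

/-- Patch test consistency of a nonlocal interface functional:
for `N = 2M` even, `J(y_F) = 0` and every homogeneous deformation is a critical point
of `J` with respect to periodic displacements. -/
theorem stmt_15 (M : ℕ) (hM : 1 ≤ M) (F : Fin 2 → Fin 2 → ℝ) :
    Jfun M (yhom2 (2 * M) F) = 0 ∧
    ∀ u : (Fin 2 → ℤ) → EuclideanSpace ℝ (Fin 2), LatPeriodic2 (2 * M) u →
      HasDerivAt (fun t : ℝ => Jfun M (yhom2 (2 * M) F + t • u)) 0 0 := by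
  constructor
  · obtain ⟨c, hc⟩ := Jfun_yhom2_add_smul M hM F 0 fun _ _ => rfl
    simpa using hc 0
  · intro u hu
    obtain ⟨c, hc⟩ := Jfun_yhom2_add_smul M hM F u hu
    simp only [hc]
    simpa using (hasDerivAt_pow 2 (0 : ℝ)).const_mul c
end
end

section
/- (Necessity of the scaling condition: lower bound for an interface functional with O(1) scaling.) Assume N is even, let β > 0, define 𝓛^i_± := { x ∈ 𝓛 : x₂ = ±1/2 } and the functional 𝒥(y) := β ε² ( Σ_{x∈𝓛^i_+} |D_{e₁}y(x)|² − Σ_{x∈𝓛^i_−} |D_{e₁}y(x)|² ). Let A ∈ ℝ^{2×2} and let y : εℤ² → ℝ² satisfy: y − y_A is periodic, and y(x) = Ax for all x ∈ 𝓛 with x₂ = −1/2. Then there exists a periodic displacement u ∈ 𝓤 with ‖∇u‖_ε = 1 such that d/dt 𝒥(y + t u)|_{t=0} ≥ β ε ( ε Σ_{x∈𝓛^i_+} |D_{e₁}y(x) − A e₁|² )^{1/2}, where ‖∇u‖_ε := ( ε² Σ_{x∈𝓛} (|D_{e₁}u(x)|² + |D_{e₂}u(x)|²) )^{1/2}. 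-/
open scoped BigOperators

noncomputable section

/-- `𝓛^i_+`: the row `x₂ = 1/2`, i.e. `x 1 = M` (with `N = 2M`). -/
def Lplus (M : ℕ) : Finset (Fin 2 → ℤ) :=
  (cell2 (2 * M)).filter fun x => x 1 = (M : ℤ)

/-- `𝓛^i_−`: the row `x₂ = −1/2`, i.e. `x 1 = −M` (with `N = 2M`). -/
def Lminus (M : ℕ) : Finset (Fin 2 → ℤ) :=
  (cell2 (2 * M)).filter fun x => x 1 = -(M : ℤ)

/-- The interface functional
`𝒥(y) = βε²(∑_{x∈𝓛^i_+} |D_{e₁}y(x)|² − ∑_{x∈𝓛^i_−} |D_{e₁}y(x)|²)`. -/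
def Jscal (M : ℕ) (β : ℝ) (y : (Fin 2 → ℤ) → EuclideanSpace ℝ (Fin 2)) : ℝ :=
  β * (1 / (2 * M : ℝ)) ^ 2 *
    (∑ x ∈ Lplus M, ‖fd2 (1 / (2 * M : ℝ)) (eint 0) y x‖ ^ 2
      - ∑ x ∈ Lminus M, ‖fd2 (1 / (2 * M : ℝ)) (eint 0) y x‖ ^ 2)

/-- The discrete `W^{1,2}`-seminorm
`‖∇u‖_ε = (ε² ∑_{x∈𝓛} (|D_{e₁}u(x)|² + |D_{e₂}u(x)|²))^{1/2}`. -/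
def gradNorm (M : ℕ) (u : (Fin 2 → ℤ) → EuclideanSpace ℝ (Fin 2)) : ℝ :=
  Real.sqrt ((1 / (2 * M : ℝ)) ^ 2 * ∑ x ∈ cell2 (2 * M),
    (‖fd2 (1 / (2 * M : ℝ)) (eint 0) u x‖ ^ 2 + ‖fd2 (1 / (2 * M : ℝ)) (eint 1) u x‖ ^ 2))

theorem fd2_add (ε : ℝ) (r : Fin 2 → ℤ) (v w : (Fin 2 → ℤ) → EuclideanSpace ℝ (Fin 2))
    (x : Fin 2 → ℤ) : fd2 ε r (v + w) x = fd2 ε r v x + fd2 ε r w x := by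
  simp only [fd2, Pi.add_apply, ← smul_add]
  congr 1
  abel

theorem fd2_smul (ε c : ℝ) (r : Fin 2 → ℤ) (v : (Fin 2 → ℤ) → EuclideanSpace ℝ (Fin 2))
    (x : Fin 2 → ℤ) : fd2 ε r (c • v) x = c • fd2 ε r v x := by
  simp only [fd2, Pi.smul_apply, ← smul_sub]
  exact smul_comm _ _ _

theorem vec_add_eint_zero (k l : ℤ) : (![k, l] : Fin 2 → ℤ) + eint 0 = ![k + 1, l] := by
  ext i; fin_cases i <;> simp [eint]

theorem vec_add_eint_one (k l : ℤ) : (![k, l] : Fin 2 → ℤ) + eint 1 = ![k, l + 1] := by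
  ext i; fin_cases i <;> simp [eint]

theorem vec_eta (x : Fin 2 → ℤ) : ![x 0, x 1] = x := by
  ext i; fin_cases i <;> rfl

theorem mem_cell2 (N : ℕ) (x : Fin 2 → ℤ) :
    x ∈ cell2 N ↔ (-(N : ℤ) + 1 ≤ x 0 ∧ x 0 ≤ N) ∧ (-(N : ℤ) + 1 ≤ x 1 ∧ x 1 ≤ N) := by
  simp [cell2, Fin.forall_fin_two]

theorem sum_cell2 {E : Type*} [AddCommMonoid E] (N : ℕ) (f : (Fin 2 → ℤ) → E) :
    ∑ x ∈ cell2 N, f x =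
      ∑ l ∈ Finset.Icc (-(N : ℤ) + 1) N, ∑ k ∈ Finset.Icc (-(N : ℤ) + 1) N, f ![k, l] := by
  rw [← Finset.sum_product']
  refine Finset.sum_nbij' (fun x => (x 1, x 0)) (fun p => ![p.2, p.1]) ?_ ?_ ?_ ?_ ?_
  · intro x hx
    simp only [mem_cell2] at hx
    simp only [Finset.mem_product, Finset.mem_Icc]
    tauto
  · intro p hp
    simp only [Finset.mem_product, Finset.mem_Icc] at hp
    simp only [mem_cell2, Matrix.cons_val_zero, Matrix.cons_val_one]
    tauto
  · intro x _
    exact vec_eta x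
  · intro p _
    rfl
  · intro x _
    exact congrArg f (vec_eta x).symm

theorem sum_cell2_row {E : Type*} [AddCommMonoid E] (N : ℕ) (m : ℤ)
    (hm : -(N : ℤ) + 1 ≤ m ∧ m ≤ N) (f : (Fin 2 → ℤ) → E) :
    ∑ x ∈ (cell2 N).filter (fun x => x 1 = m), f x =
      ∑ k ∈ Finset.Icc (-(N : ℤ) + 1) N, f ![k, m] := by
  rw [Finset.sum_filter, sum_cell2, Finset.sum_comm]
  refine Finset.sum_congr rfl fun k _ => ?_
  simp [hm]

theorem sum_Ico_int_sub {E : Type*} [AddCommGroup E] (g : ℤ → E) (a : ℤ) (n : ℕ) :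
    ∑ k ∈ Finset.Ico a (a + n), (g (k + 1) - g k) = g (a + n) - g a := by
  induction n with
  | zero => simp
  | succ n ih =>
    have h : Finset.Ico a (a + (n + 1 : ℕ)) = insert (a + n) (Finset.Ico a (a + n)) := by
      ext k; simp only [Finset.mem_Ico, Finset.mem_insert]; push_cast; omega
    rw [h, Finset.sum_insert (by simp), ih]
    push_cast
    rw [add_assoc]
    abel

/-- The sum of the horizontal difference quotients of a periodic lattice function over a full
period vanishes. -/
theorem sum_fd2_row_eq_zero {N : ℕ} {u : (Fin 2 → ℤ) → EuclideanSpace ℝ (Fin 2)}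
    (hu : LatPeriodic2 N u) (ε : ℝ) (m : ℤ) :
    ∑ k ∈ Finset.Icc (-(N : ℤ) + 1) N, fd2 ε (eint 0) u ![k, m] = 0 := by
  have hI : Finset.Icc (-(N : ℤ) + 1) N =
      Finset.Ico (-(N : ℤ) + 1) (-(N : ℤ) + 1 + (2 * N : ℕ)) := by
    ext k; simp only [Finset.mem_Icc, Finset.mem_Ico]; push_cast; omega
  have h := hu ![-(N : ℤ) + 1, m] (eint 0)
  have hx : (![-(N : ℤ) + 1, m] : Fin 2 → ℤ) + (2 * N : ℤ) • eint 0 =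
      ![-(N : ℤ) + 1 + (2 * N : ℕ), m] := by
    ext i; fin_cases i <;> simp [eint]
  rw [hx] at h
  simp only [fd2, vec_add_eint_zero, ← Finset.smul_sum]
  rw [hI, sum_Ico_int_sub (fun k => u ![k, m]), h, sub_self, smul_zero]

theorem gradNorm_smul (M : ℕ) (c : ℝ) (u : (Fin 2 → ℤ) → EuclideanSpace ℝ (Fin 2)) :
    gradNorm M (c • u) = |c| * gradNorm M u := by
  simp only [gradNorm, fd2_smul, norm_smul, mul_pow, ← mul_add, ← Finset.mul_sum]
  rw [mul_left_comm, Real.sqrt_mul (by positivity), Real.norm_eq_abs, sq_abs, Real.sqrt_sq_eq_abs]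

theorem LatPeriodic2.smul {N : ℕ} {u : (Fin 2 → ℤ) → EuclideanSpace ℝ (Fin 2)}
    (hu : LatPeriodic2 N u) (c : ℝ) : LatPeriodic2 N (c • u) := fun x ξ => by
  simp only [Pi.smul_apply, hu x ξ]

theorem hasDerivAt_sum_norm_fd2_sq (s : Finset (Fin 2 → ℤ)) (ε : ℝ) (r : Fin 2 → ℤ)
    (y u : (Fin 2 → ℤ) → EuclideanSpace ℝ (Fin 2)) :
    HasDerivAt (fun t : ℝ => ∑ x ∈ s, ‖fd2 ε r (y + t • u) x‖ ^ 2)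
      (∑ x ∈ s, 2 * inner ℝ (fd2 ε r y x) (fd2 ε r u x)) 0 := by
  refine HasDerivAt.fun_sum fun x _ => ?_
  simp only [fd2_add, fd2_smul]
  have h : HasDerivAt (fun t : ℝ => fd2 ε r y x + t • fd2 ε r u x) (fd2 ε r u x) 0 := by
    simpa using ((hasDerivAt_id (0 : ℝ)).smul_const (fd2 ε r u x)).const_add (fd2 ε r y x)
  simpa using h.norm_sq

theorem hasDerivAt_Jscal (M : ℕ) (β : ℝ) (y u : (Fin 2 → ℤ) → EuclideanSpace ℝ (Fin 2)) :
    HasDerivAt (fun t : ℝ => Jscal M β (y + t • u))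
      (β * (1 / (2 * M : ℝ)) ^ 2 *
        (∑ x ∈ Lplus M, 2 * inner ℝ (fd2 (1 / (2 * M : ℝ)) (eint 0) y x)
            (fd2 (1 / (2 * M : ℝ)) (eint 0) u x)
          - ∑ x ∈ Lminus M, 2 * inner ℝ (fd2 (1 / (2 * M : ℝ)) (eint 0) y x)
            (fd2 (1 / (2 * M : ℝ)) (eint 0) u x))) 0 :=
  ((hasDerivAt_sum_norm_fd2_sq _ _ _ y u).sub (hasDerivAt_sum_norm_fd2_sq _ _ _ y u)).const_mul _

/-- If `D_{e₁} y` is constantly `a` on the lower interface row, the first variation of `Jscal` in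
a periodic direction only sees the deviation of `D_{e₁} y` from `a` on the upper row. -/
theorem hasDerivAt_Jscal_of_bot {M : ℕ} (hM : 1 ≤ M) (β : ℝ)
    {y u : (Fin 2 → ℤ) → EuclideanSpace ℝ (Fin 2)} (hu : LatPeriodic2 (2 * M) u)
    (a : EuclideanSpace ℝ (Fin 2))
    (ha : ∀ x ∈ Lminus M, fd2 (1 / (2 * M : ℝ)) (eint 0) y x = a) :
    HasDerivAt (fun t : ℝ => Jscal M β (y + t • u))
      (2 * β * (1 / (2 * M : ℝ)) ^ 2 *
        ∑ x ∈ Lplus M, inner ℝ (fd2 (1 / (2 * M : ℝ)) (eint 0) y x - a)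
            (fd2 (1 / (2 * M : ℝ)) (eint 0) u x)) 0 := by
  convert hasDerivAt_Jscal M β y u using 1
  have hzero : ∀ m : ℤ, -((2 * M : ℕ) : ℤ) + 1 ≤ m ∧ m ≤ (2 * M : ℕ) →
      ∑ x ∈ (cell2 (2 * M)).filter (fun x => x 1 = m),
        inner ℝ a (fd2 (1 / (2 * M : ℝ)) (eint 0) u x) = 0 := by
    intro m hm
    rw [← inner_sum, sum_cell2_row _ _ hm, sum_fd2_row_eq_zero hu, inner_zero_right]
  have hp := hzero M (by push_cast; omega)
  have hm := hzero (-M) (by push_cast; omega)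
  have hbot : ∑ x ∈ Lminus M, inner ℝ (fd2 (1 / (2 * M : ℝ)) (eint 0) y x)
      (fd2 (1 / (2 * M : ℝ)) (eint 0) u x) = 0 := by
    rw [← hm]
    exact Finset.sum_congr rfl fun x hx => by rw [ha x hx]
  simp only [inner_sub_left, Finset.sum_sub_distrib, ← Finset.mul_sum, hbot]
  rw [Lplus, hp]
  ring

/-- The oscillating displacement `x ↦ (-1)^{x₁} e₁` is periodic with positive seminorm. -/
theorem exists_latPeriodic2_gradNorm_pos {M : ℕ} (hM : 1 ≤ M) :
    ∃ v : (Fin 2 → ℤ) → EuclideanSpace ℝ (Fin 2), LatPeriodic2 (2 * M) v ∧ 0 < gradNorm M v := by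
  have hMr : (0 : ℝ) < M := by exact_mod_cast hM
  refine ⟨fun x => if Even (x 0) then toV2 ![1, 0] else 0, ?_, ?_⟩
  · intro x ξ
    have h : Even ((x + (2 * (2 * M : ℕ) : ℤ) • ξ) 0) ↔ Even (x 0) := by
      simp [Int.even_add, Int.even_mul]
    simp only [h]
  · refine Real.sqrt_pos.2 (mul_pos (by positivity) ?_)
    refine Finset.sum_pos' (fun x _ => by positivity) ⟨0, ?_, ?_⟩
    · rw [mem_cell2]; simp; omega
    · refine add_pos_of_pos_of_nonneg (pow_pos (norm_pos_iff.2 ?_) 2) (by positivity)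
      have h1 : ¬ Even ((0 + eint 0 : Fin 2 → ℤ) 0) := by simp [eint]
      have hne : toV2 ![1, 0] ≠ 0 := fun h => by
        simpa [toV2] using congrArg (fun w : EuclideanSpace ℝ (Fin 2) => w 0) h
      simp only [fd2, h1]
      simp [hne, hMr.ne']

/-- Necessity of the scaling condition: if `y − y_A` is periodic and
`y = y_A` on the bottom interface row, then there is a periodic displacement `u` with
`‖∇u‖_ε = 1` such that the first variation of `𝒥` at `y` in direction `u` is at least
`βε (ε ∑_{x∈𝓛^i_+} |D_{e₁}y(x) − Ae₁|²)^{1/2}`. -/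
theorem stmt_16 (M : ℕ) (hM : 1 ≤ M) (β : ℝ) (hβ : 0 < β)
    (A : Fin 2 → Fin 2 → ℝ)
    (y : (Fin 2 → ℤ) → EuclideanSpace ℝ (Fin 2))
    (hyper : ∀ x ξ : Fin 2 → ℤ,
      y (x + (2 * (2 * M) : ℤ) • ξ) = y x + toV2 fun i => ∑ j, A i j * (2 * (ξ j : ℝ)))
    (hbot : ∀ x ∈ cell2 (2 * M), x 1 = -(M : ℤ) →
      y x = toV2 fun i => ∑ j, A i j * ((1 / (2 * M : ℝ)) * (x j : ℝ))) :
    ∃ (u : (Fin 2 → ℤ) → EuclideanSpace ℝ (Fin 2)) (D : ℝ),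
      LatPeriodic2 (2 * M) u ∧
      gradNorm M u = 1 ∧
      HasDerivAt (fun t : ℝ => Jscal M β (y + t • u)) D 0 ∧
      β * (1 / (2 * M : ℝ)) * Real.sqrt ((1 / (2 * M : ℝ)) * ∑ x ∈ Lplus M,
          ‖fd2 (1 / (2 * M : ℝ)) (eint 0) y x - toV2 (fun i => A i 0)‖ ^ 2) ≤ D := by
  have hMr : (0 : ℝ) < M := by exact_mod_cast hM
  set a : EuclideanSpace ℝ (Fin 2) := toV2 fun i => A i 0 with ha_def
  have haff : ∀ k l : ℤ, toV2 (fun i => ∑ j, A i j * ((1 / (2 * M : ℝ)) * ((![k, l] j : ℤ) : ℝ)))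
      = ((1 / (2 * M : ℝ)) * k) • a + ((1 / (2 * M : ℝ)) * l) • toV2 fun i => A i 1 := by
    intro k l
    ext i
    simp [toV2, a, Fin.sum_univ_two]
    ring
  have hshift : ∀ k l n : ℤ, y ![k + 2 * (2 * M) * n, l] = y ![k, l] + (2 * n : ℝ) • a := by
    intro k l n
    have h := hyper ![k, l] (n • eint 0)
    have hx : (![k, l] : Fin 2 → ℤ) + (2 * (2 * M) : ℤ) • (n • eint 0) =
        ![k + 2 * (2 * M) * n, l] := by
      ext i; fin_cases i <;> simp [eint]
    rw [hx] at h
    rw [h]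
    congr 1
    ext i
    simp [toV2, a, eint, Fin.sum_univ_two]
    ring
  have hrow : ∀ k : ℤ, -((2 * M : ℕ) : ℤ) + 1 ≤ k ∧ k ≤ (2 * M : ℕ) → y ![k, -(M : ℤ)] =
      ((1 / (2 * M : ℝ)) * k) • a +
        ((1 / (2 * M : ℝ)) * ((-(M : ℤ) : ℤ) : ℝ)) • toV2 fun i => A i 1 := by
    intro k hk
    rw [← haff]
    refine hbot _ ((mem_cell2 _ _).2 ⟨hk, ?_⟩) rfl
    simp only [Matrix.cons_val_one, Matrix.cons_val_zero]
    push_cast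
    omega
  have ha : ∀ x ∈ Lminus M, fd2 (1 / (2 * M : ℝ)) (eint 0) y x = a := by
    intro x hx
    obtain ⟨hx, hx1⟩ := Finset.mem_filter.1 hx
    obtain ⟨hk, -⟩ := (mem_cell2 _ _).1 hx
    rw [← vec_eta x, hx1]
    generalize x 0 = k at hk
    have hnext : y ![k + 1, -(M : ℤ)] = ((1 / (2 * M : ℝ)) * (k + 1 : ℝ)) • a +
        ((1 / (2 * M : ℝ)) * ((-(M : ℤ) : ℤ) : ℝ)) • toV2 fun i => A i 1 := by
      by_cases hkN : k + 1 ≤ (2 * M : ℕ)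
      · rw [hrow (k + 1) ⟨by omega, hkN⟩]
        push_cast
        rfl
      · have hkeq : k = 2 * M := by push_cast at hk hkN; omega
        have hs := hshift (-(2 * M) + 1) (-(M : ℤ)) 1
        rw [hrow (-(2 * M) + 1) (by push_cast; omega)] at hs
        have he : (-(2 * M) + 1 + 2 * (2 * M) * 1 : ℤ) = k + 1 := by rw [hkeq]; ring
        rw [he] at hs
        rw [hs, hkeq, add_right_comm, ← add_smul]
        congr 2
        push_cast
        field_simp
        ring
    rw [fd2, vec_add_eint_zero, hnext, hrow k hk, add_sub_add_right_eq_sub, ← sub_smul, smul_smul]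
    convert one_smul ℝ a using 2
    field_simp
    ring
  set ε : ℝ := 1 / (2 * M : ℝ) with hε
  have hεpos : 0 < ε := by positivity
  set S : ℝ := ∑ x ∈ Lplus M, ‖fd2 ε (eint 0) y x - a‖ ^ 2 with hS
  have hSnn : 0 ≤ S := Finset.sum_nonneg fun x _ => by positivity
  rcases hSnn.eq_or_lt with hS0 | hSpos
  · obtain ⟨v, hv, hg⟩ := exists_latPeriodic2_gradNorm_pos hM
    have hu := hv.smul (gradNorm M v)⁻¹
    refine ⟨(gradNorm M v)⁻¹ • v, _, hu, ?_, hasDerivAt_Jscal_of_bot hM β hu a ha, ?_⟩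
    · rw [gradNorm_smul, abs_of_pos (inv_pos.2 hg), inv_mul_cancel₀ hg.ne']
    · rw [← hS0]
      have hz : ∀ x ∈ Lplus M, fd2 ε (eint 0) y x - a = 0 := fun x hx => by
        have := (Finset.sum_eq_zero_iff_of_nonneg
          (fun x _ => by positivity)).1 (hS.symm.trans hS0.symm) x hx
        simpa using this
      rw [Finset.sum_eq_zero fun x hx => by rw [hz x hx, inner_zero_left]]
      simp
  · -- the deviation from `A` on the upper row, extended constantly in the vertical direction
    set v : (Fin 2 → ℤ) → EuclideanSpace ℝ (Fin 2) :=
      fun x => y ![x 0, M] - (ε * (x 0 : ℝ)) • a with hv_def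
    have hv : LatPeriodic2 (2 * M) v := by
      intro x ξ
      have hx0 : (x + (2 * (2 * M : ℕ) : ℤ) • ξ) 0 = x 0 + 2 * (2 * M) * ξ 0 := by
        simp
      simp only [hv_def, hx0, hshift]
      have : ε * ((x 0 + 2 * (2 * M) * ξ 0 : ℤ) : ℝ) = ε * (x 0 : ℝ) + 2 * (ξ 0 : ℝ) := by
        rw [hε]; push_cast; field_simp
      rw [this, add_smul]
      abel
    have hv0 : ∀ k l : ℤ, fd2 ε (eint 0) v ![k, l] = fd2 ε (eint 0) y ![k, M] - a := by
      intro k l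
      simp only [fd2, vec_add_eint_zero, hv_def, Matrix.cons_val_zero]
      push_cast
      rw [mul_add, add_smul, mul_one]
      have : a = ε⁻¹ • (ε • a) := by rw [smul_smul, inv_mul_cancel₀ hεpos.ne', one_smul]
      nth_rewrite 4 [this]
      rw [← smul_sub]
      congr 1
      abel
    have hv1 : ∀ k l : ℤ, fd2 ε (eint 1) v ![k, l] = 0 := by
      intro k l
      simp only [fd2, vec_add_eint_one, hv_def, Matrix.cons_val_zero, sub_self, smul_zero]
    have hM_mem : -((2 * M : ℕ) : ℤ) + 1 ≤ M ∧ (M : ℤ) ≤ (2 * M : ℕ) := by push_cast; omega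
    have hS_row : S = ∑ k ∈ Finset.Icc (-((2 * M : ℕ) : ℤ) + 1) (2 * M : ℕ),
        ‖fd2 ε (eint 0) y ![k, M] - a‖ ^ 2 := sum_cell2_row _ _ hM_mem _
    have hg : gradNorm M v = Real.sqrt (2 * (ε * S)) := by
      rw [gradNorm, ← hε, sum_cell2]
      simp only [hv0, hv1, norm_zero]
      simp only [ne_eq, OfNat.ofNat_ne_zero, not_false_eq_true, zero_pow, add_zero, ← hS_row,
        Finset.sum_const, Int.card_Icc, nsmul_eq_mul]
      have hcard : (((2 * M : ℕ) : ℤ) + 1 - (-((2 * M : ℕ) : ℤ) + 1)).toNat = 4 * M := by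
        push_cast; omega
      rw [hcard, hε]
      congr 1
      push_cast
      field_simp
      norm_num
    have hεS : 0 < ε * S := mul_pos hεpos hSpos
    have hgpos : 0 < gradNorm M v := hg ▸ Real.sqrt_pos.2 (by positivity)
    have hu := hv.smul (gradNorm M v)⁻¹
    refine ⟨(gradNorm M v)⁻¹ • v, _, hu, ?_, hasDerivAt_Jscal_of_bot hM β hu a ha, ?_⟩
    · rw [gradNorm_smul, abs_of_pos (inv_pos.2 hgpos), inv_mul_cancel₀ hgpos.ne']
    · have hsum : ∑ x ∈ Lplus M, inner ℝ (fd2 ε (eint 0) y x - a)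
          (fd2 ε (eint 0) ((gradNorm M v)⁻¹ • v) x) = (gradNorm M v)⁻¹ * S := by
        rw [hS, Finset.mul_sum]
        refine Finset.sum_congr rfl fun x hx => ?_
        have hx1 := (Finset.mem_filter.1 hx).2
        have h := hv0 (x 0) (x 1)
        rw [← hx1, vec_eta] at h
        rw [fd2_smul, h, inner_smul_right, real_inner_self_eq_norm_sq]
      rw [← hε, hsum]
      have hle : Real.sqrt (ε * S) * gradNorm M v ≤ 2 * (ε * S) := by
        rw [hg, ← Real.sqrt_mul hεS.le]
        refine Real.sqrt_le_iff.2 ⟨by positivity, ?_⟩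
        nlinarith [sq_nonneg (ε * S)]
      have hle' : Real.sqrt (ε * S) ≤ 2 * (ε * S) * (gradNorm M v)⁻¹ := by
        rw [← div_eq_mul_inv, le_div_iff₀ hgpos]
        exact hle
      calc β * ε * Real.sqrt (ε * S) ≤ β * ε * (2 * (ε * S) * (gradNorm M v)⁻¹) := by gcongr
        _ = 2 * β * ε ^ 2 * ((gradNorm M v)⁻¹ * S) := by ring
end
end
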